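/- arXiv:1506.01202 — 2 statements merged into one kernel-verified Lean document; each statement's English description precedes it below -/
import Mathlib

section
/- There exists a plaid polygon Γ contained in the first block [0,ω]² whose x-diameter (the diameter of its orthogonal projection to the x-axis) is at least ω²/(2q) − 1. Moreover, Γ is invariant under the reflection in the horizontal midline y = ω/2 of the block. -/
noncomputable section
open scoped Classical

/-- The representative of `x` modulo `2ℤ` lying in `[-1,1)`.  For the values arising in the
plaid model (which are never congruent to an odd integer modulo `2ℤ`) this is the unique
representative in `(-1,1)`. -/
def nrm (x : ℝ) : ℝ := x - 2 * ⌊(x + 1) / 2⌋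

/-- An even rational parameter `p/q`: coprime positive integers `p < q` with `p*q` even. -/
structure Param where
  p : ℕ
  q : ℕ
  p_pos : 0 < p
  p_lt_q : p < q
  coprime : Nat.Coprime p q
  even_pq : Even (p * q)

/-- `z` lies on a line of the family `𝓗` (horizontal lines with integer `y`-coordinate). -/
def onH (z : ℝ × ℝ) : Prop := ∃ n : ℤ, z.2 = (n : ℝ)

/-- `z` lies on a line of the family `𝓥` (vertical lines with integer `x`-coordinate). -/
def onV (z : ℝ × ℝ) : Prop := ∃ n : ℤ, z.1 = (n : ℝ)

/-- The lightness condition on the pair of values `(F_A(z), F_B(z))`: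
`F_A(z)·F_B(z) > 0` and `|F_B(z)| < |F_A(z)|`. -/
def lightPair (a b : ℝ) : Prop := a * b > 0 ∧ |b| < |a|

namespace Param

variable (π : Param)

def ω : ℕ := π.p + π.q

def P : ℝ := 2 * π.p / π.ω

def Q : ℝ := 2 * π.q / π.ω

/-- `z` lies on a line of `𝓟` (slope `-P`, integer `y`-intercept). -/
def onP (z : ℝ × ℝ) : Prop := ∃ n : ℤ, z.2 + π.P * z.1 = (n : ℝ)

/-- `z` lies on a line of `𝓠` (slope `-Q`, integer `y`-intercept). -/
def onQ (z : ℝ × ℝ) : Prop := ∃ n : ℤ, z.2 + π.Q * z.1 = (n : ℝ)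

def FH (z : ℝ × ℝ) : ℝ := nrm (2 * π.P * z.2)
def FV (z : ℝ × ℝ) : ℝ := nrm (2 * π.P * z.1)
def FP (z : ℝ × ℝ) : ℝ := nrm (π.P * z.2 + π.P ^ 2 * z.1 + 1)
def FQ (z : ℝ × ℝ) : ℝ := nrm (π.P * z.2 + π.P * π.Q * z.1 + 1)

/-- `z` is a light intersection point of type `P` on a horizontal (`𝓗`) line. -/
def lightHP (z : ℝ × ℝ) : Prop := onH z ∧ π.onP z ∧ lightPair (π.FH z) (π.FP z)

/-- `z` is a light intersection point of type `Q` on a horizontal (`𝓗`) line. -/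
def lightHQ (z : ℝ × ℝ) : Prop := onH z ∧ π.onQ z ∧ lightPair (π.FH z) (π.FQ z)

/-- `z` is a light intersection point of type `P` on a vertical (`𝓥`) line. -/
def lightVP (z : ℝ × ℝ) : Prop := onV z ∧ π.onP z ∧ lightPair (π.FV z) (π.FP z)

/-- `z` is a light intersection point of type `Q` on a vertical (`𝓥`) line. -/
def lightVQ (z : ℝ × ℝ) : Prop := onV z ∧ π.onQ z ∧ lightPair (π.FV z) (π.FQ z)

/-- `z` is a light point (of some kind). -/
def light (z : ℝ × ℝ) : Prop := π.lightHP z ∨ π.lightHQ z ∨ π.lightVP z ∨ π.lightVQ z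

/-- The number of light points, with the double-counting convention (a light point which is the
midpoint of the segment, lying simultaneously on a `𝓟` line and a `𝓠` line, counts twice), on
the horizontal unit segment from `(m,n)` to `(m+1,n)`. -/
def hLightCount (m n : ℤ) : ℕ :=
  Set.ncard {x : ℝ | x ∈ Set.Icc (m : ℝ) ((m : ℝ) + 1) ∧ π.lightHP (x, (n : ℝ))} +
  Set.ncard {x : ℝ | x ∈ Set.Icc (m : ℝ) ((m : ℝ) + 1) ∧ π.lightHQ (x, (n : ℝ)) ∧
    (π.onP (x, (n : ℝ)) → x = (m : ℝ) + 1 / 2)}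

/-- The number of light points on the vertical unit segment from `(m,n)` to `(m,n+1)`. -/
def vLightCount (m n : ℤ) : ℕ :=
  Set.ncard {y : ℝ | y ∈ Set.Icc (n : ℝ) ((n : ℝ) + 1) ∧ π.lightVP ((m : ℝ), y)} +
  Set.ncard {y : ℝ | y ∈ Set.Icc (n : ℝ) ((n : ℝ) + 1) ∧ π.lightVQ ((m : ℝ), y)}

/-- The horizontal unit segment from `(m,n)` to `(m+1,n)` is good: it contains exactly one
light point (with the double-counting convention). -/
def goodH (m n : ℤ) : Prop := π.hLightCount m n = 1

/-- The vertical unit segment from `(m,n)` to `(m,n+1)` is good. -/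
def goodV (m n : ℤ) : Prop := π.vLightCount m n = 1

end Param

namespace Param

variable (π : Param)

/-- The union of all the plaid polygons: in each integer unit square (with corners `(m,n)` and
`(m+1,n+1)`) we draw the segments connecting the center of the square to the midpoints of its
good edges. -/
def plaidSet : Set (ℝ × ℝ) :=
  {z | ∃ m n : ℤ,
    (π.goodH m n ∧ z ∈ segment ℝ ((m : ℝ) + 1 / 2, (n : ℝ) + 1 / 2) ((m : ℝ) + 1 / 2, (n : ℝ))) ∨
    (π.goodH m (n + 1) ∧
      z ∈ segment ℝ ((m : ℝ) + 1 / 2, (n : ℝ) + 1 / 2) ((m : ℝ) + 1 / 2, (n : ℝ) + 1)) ∨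
    (π.goodV m n ∧ z ∈ segment ℝ ((m : ℝ) + 1 / 2, (n : ℝ) + 1 / 2) ((m : ℝ), (n : ℝ) + 1 / 2)) ∨
    (π.goodV (m + 1) n ∧
      z ∈ segment ℝ ((m : ℝ) + 1 / 2, (n : ℝ) + 1 / 2) ((m : ℝ) + 1, (n : ℝ) + 1 / 2))}

/-- A plaid polygon: a connected component of the union of the drawn segments. -/
def IsPlaidPolygon (Γ : Set (ℝ × ℝ)) : Prop :=
  ∃ z ∈ π.plaidSet, Γ = connectedComponentIn π.plaidSet z

end Param

/-! ### Integer form of lightness -/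

/-- Lightness of a crossing, with all values scaled by `W = ω`. -/
def ltI (W A C : ℤ) : Prop := lightPair (nrm ((A : ℝ) / W)) (nrm ((C : ℝ) / W))

/-- Scaled normalized representative. -/
def rp (W A : ℤ) : ℤ := A - 2 * W * ((A + W) / (2 * W))

lemma rp_bounds {W : ℤ} (hW : 0 < W) (A : ℤ) : -W ≤ rp W A ∧ rp W A < W := by
  unfold rp
  have h1 := Int.emod_nonneg (A + W) (b := 2 * W) (by omega)
  have h2 := Int.emod_lt_of_pos (A + W) (b := 2 * W) (by omega)
  have h3 := Int.emod_add_mul_ediv (A + W) (2 * W)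
  constructor <;> linarith

lemma nrm_int {W : ℤ} (hW : 0 < W) (A : ℤ) : nrm ((A : ℝ) / W) = (rp W A : ℝ) / W := by
  have hb := rp_bounds hW A
  have hWR : (0 : ℝ) < W := by exact_mod_cast hW
  have hfl : ⌊((A : ℝ) / W + 1) / 2⌋ = (A + W) / (2 * W) := by
    rw [Int.floor_eq_iff]
    have e1 : ((A : ℝ) / W + 1) / 2 = ((A : ℝ) + W) / (2 * W) := by field_simp
    rw [e1]
    unfold rp at hb
    obtain ⟨b1, b2⟩ := hb
    have b1' : (-(W : ℝ)) ≤ A - 2 * W * (((A + W) / (2 * W) : ℤ) : ℝ) := by exact_mod_cast b1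
    have b2' : (A - 2 * W * (((A + W) / (2 * W) : ℤ) : ℝ)) < W := by exact_mod_cast b2
    constructor
    · rw [le_div_iff₀ (by positivity)]; linarith
    · rw [div_lt_iff₀ (by positivity)]; linarith
  unfold nrm
  rw [hfl]
  unfold rp
  push_cast
  field_simp

lemma ltI_iff {W : ℤ} (hW : 0 < W) (A C : ℤ) :
    ltI W A C ↔ (0 < rp W C ∧ rp W C < rp W A) ∨ (rp W A < rp W C ∧ rp W C < 0) := by
  unfold ltI lightPair
  rw [nrm_int hW, nrm_int hW]
  have hWR : (0 : ℝ) < W := by exact_mod_cast hW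
  generalize rp W A = a
  generalize rp W C = c
  rw [abs_div, abs_div, abs_of_pos hWR, div_lt_div_iff_of_pos_right hWR]
  have e : (a : ℝ) / W * (c / W) > 0 ↔ 0 < a * c := by
    have : (a : ℝ) / W * (c / W) = ((a * c : ℤ) : ℝ) / (W * W) := by push_cast; field_simp
    rw [this, gt_iff_lt, div_pos_iff_of_pos_right (by positivity)]
    exact_mod_cast Iff.rfl
  rw [e]
  have e2 : |(c : ℝ)| < |(a : ℝ)| ↔ |c| < |a| := by exact_mod_cast Iff.rfl
  rw [e2]
  constructor
  · rintro ⟨h1, h2⟩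
    rcases mul_pos_iff.1 h1 with ⟨ha, hc⟩ | ⟨ha, hc⟩
    · rw [abs_of_pos ha, abs_of_pos hc] at h2; exact Or.inl ⟨hc, h2⟩
    · rw [abs_of_neg ha, abs_of_neg hc] at h2; exact Or.inr ⟨by omega, hc⟩
  · rintro (⟨h1, h2⟩ | ⟨h1, h2⟩)
    · have ha : 0 < a := by omega
      refine ⟨mul_pos ha h1, ?_⟩
      rw [abs_of_pos ha, abs_of_pos h1]; exact h2
    · have ha : a < 0 := by omega
      refine ⟨mul_pos_of_neg_of_neg ha h2, ?_⟩
      rw [abs_of_neg ha, abs_of_neg h2]; omega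

/-- Indicator of lightness in `ZMod 2`. -/
def ell (W A C : ℤ) : ZMod 2 := if ltI W A C then 1 else 0

/-- Parity of `⌊x / 2W⌋`. -/
def ee (W x : ℤ) : ZMod 2 := ((x / (2 * W) : ℤ) : ZMod 2)

lemma ell_eq {W : ℤ} (hW : 0 < W) (hodd : Odd W) {A C : ℤ} (hA : Even A) (hC : Odd C) :
    ell W A C = ee W C + ee W (C - A) + ee W (A + W) := by
  unfold ell ee
  rw [ltI_iff hW]
  obtain ⟨a1, a2⟩ := rp_bounds hW A
  obtain ⟨c1, c2⟩ := rp_bounds hW C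
  set α := (A + W) / (2 * W) with hα
  set γ := (C + W) / (2 * W) with hγ
  have ea : A = rp W A + 2 * W * α := by simp [rp, hα]
  have ec : C = rp W C + 2 * W * γ := by simp [rp, hγ]
  have pa : Even (rp W A) := by
    unfold rp; exact hA.sub (by rw [mul_assoc]; exact even_two_mul _)
  have pc : Odd (rp W C) := by
    unfold rp; exact hC.sub_even (by rw [mul_assoc]; exact even_two_mul _)
  generalize rp W A = a at *
  generalize rp W C = c at *
  have f1 : C / (2 * W) = γ + c / (2 * W) := by
    rw [ec, add_comm, Int.mul_add_ediv_left _ _ (by omega)]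
  have f2 : (C - A) / (2 * W) = γ - α + (c - a) / (2 * W) := by
    have : C - A = 2 * W * (γ - α) + (c - a) := by rw [ec, ea]; ring
    rw [this, Int.mul_add_ediv_left _ _ (by omega)]
  rw [f1, f2]
  have neg : ∀ x : ℤ, -(2 * W) ≤ x → x < 0 → x / (2 * W) = -1 := by
    intro x h1 h2
    rw [Int.ediv_eq_iff_of_pos (by omega)]
    omega
  have two : ∀ g al : ZMod 2, g + (g - al) + al = 0 := by decide
  have two1 : ∀ g al : ZMod 2, (g + -1) + (g - al) + al = 1 := by decide
  have two2 : ∀ g al : ZMod 2, g + (g - al + -1) + al = 1 := by decide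
  have two3 : ∀ g al : ZMod 2, (g + -1) + (g - al + -1) + al = 0 := by decide
  have hc0 : c ≠ 0 := by rintro rfl; simp at pc
  have hca : c ≠ a := by rintro rfl; exact (Int.not_even_iff_odd.2 pc) pa
  rcases lt_or_gt_of_ne hc0 with h | h <;> rcases lt_or_gt_of_ne hca with h' | h'
  · rw [neg c (by omega) h, neg (c - a) (by omega) (by omega), if_neg (by omega)]
    push_cast; exact (two3 _ _).symm
  · rw [neg c (by omega) h, Int.ediv_eq_zero_of_lt (a := c - a) (by omega) (by omega),
      if_pos (by omega)]
    push_cast; rw [add_zero]; exact (two1 _ _).symm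
  · rw [neg (c - a) (by omega) (by omega), Int.ediv_eq_zero_of_lt (a := c) (by omega) (by omega),
      if_pos (by omega)]
    push_cast; rw [add_zero]; exact (two2 _ _).symm
  · rw [Int.ediv_eq_zero_of_lt (a := c - a) (by omega) (by omega),
      Int.ediv_eq_zero_of_lt (a := c) (by omega) (by omega), if_neg (by omega)]
    push_cast; rw [add_zero, add_zero]; exact (two _ _).symm

lemma ee_add {W : ℤ} (hW : 0 < W) (x j : ℤ) : ee W (x + 2 * W * j) = ee W x + j := by
  unfold ee
  rw [add_comm, Int.mul_add_ediv_left _ _ (by omega)]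
  push_cast; ring

lemma ee_refl {W : ℤ} (hW : 0 < W) {x y : ℤ} (hx : Odd x) (h : x + y = 2 * W) :
    ee W x = ee W y := by
  have h1 := Int.emod_nonneg x (b := 2 * W) (by omega)
  have h2 := Int.emod_lt_of_pos x (b := 2 * W) (by omega)
  have h3 := Int.emod_add_mul_ediv x (2 * W)
  have h0 : x % (2 * W) ≠ 0 := by
    intro h0
    rw [h0] at h3
    have : Even x := by rw [← h3, zero_add, mul_assoc]; exact even_two_mul _
    exact (Int.not_even_iff_odd.2 hx) this
  have : y / (2 * W) = - (x / (2 * W)) := by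
    rw [Int.ediv_eq_iff_of_pos (by omega)]
    generalize x / (2 * W) = t at *
    have e1 : -t * (2 * W) = - (2 * W * t) := by ring
    have h4 : 0 < x % (2 * W) := lt_of_le_of_ne h1 (Ne.symm h0)
    constructor <;> nlinarith [h1, h2, h3, h4]
  unfold ee
  rw [this]; push_cast
  exact (ZMod.neg_eq_self_mod_two _).symm

lemma ltI_zero {W : ℤ} (hW : 0 < W) (j C : ℤ) : ¬ ltI W (2 * W * j) C := by
  rw [ltI_iff hW]
  have : rp W (2 * W * j) = 0 := by
    unfold rp
    rw [Int.mul_add_ediv_left _ _ (by omega), Int.ediv_eq_zero_of_lt (by omega) (by omega)]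
    ring
  rw [this]; omega

/-- Lightness depends only on classes mod `2W`. -/
lemma rp_add {W : ℤ} (hW : 0 < W) (A j : ℤ) : rp W (A + 2 * W * j) = rp W A := by
  unfold rp
  have : A + 2 * W * j + W = 2 * W * j + (A + W) := by ring
  rw [this, Int.mul_add_ediv_left _ _ (by omega)]
  ring

lemma ltI_add {W : ℤ} (hW : 0 < W) (A C i j : ℤ) :
    ltI W (A + 2 * W * i) (C + 2 * W * j) ↔ ltI W A C := by
  rw [ltI_iff hW, ltI_iff hW, rp_add hW, rp_add hW]

lemma rp_neg {W : ℤ} (hW : 0 < W) (A : ℤ) (h : rp W A ≠ -W) : rp W (-A) = - rp W A := by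
  obtain ⟨h1, h2⟩ := rp_bounds hW A
  have : -A = - rp W A + 2 * W * (- ((A + W) / (2 * W))) := by unfold rp; ring
  rw [this, rp_add hW]
  generalize rp W A = a at *
  conv_lhs => unfold rp
  rw [Int.ediv_eq_zero_of_lt (by omega) (by omega)]; ring

lemma ltI_neg {W : ℤ} (hW : 0 < W) (hodd : Odd W) {A C : ℤ} (hA : Even A) :
    ltI W (-A) (-C) ↔ ltI W A C := by
  rw [ltI_iff hW, ltI_iff hW]
  have hA' : rp W A ≠ -W := by
    have pa : Even (rp W A) := by
      unfold rp; exact hA.sub (by rw [mul_assoc]; exact even_two_mul _)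
    intro h; rw [h] at pa
    exact (Int.not_even_iff_odd.2 hodd) (by simpa using pa)
  rw [rp_neg hW A hA']
  obtain ⟨h1, h2⟩ := rp_bounds hW A
  by_cases hC : rp W C = -W
  · have : rp W (-C) = -W := by
      have e : -C = -W + 2 * W * (1 - ((C + W) / (2 * W))) := by unfold rp at hC; linarith
      rw [e, rp_add hW]; unfold rp; simp
    rw [this, hC]; omega
  · rw [rp_neg hW C hC]; omega

lemma ltI_sub {W : ℤ} (hW : 0 < W) (hodd : Odd W) {A C : ℤ} (hA : Even A) (hC : Odd C) :
    ltI W A (A - C) ↔ ltI W A C := by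
  have h1 := ell_eq hW hodd hA hC
  have h2 := ell_eq hW hodd hA (hA.sub_odd hC)
  have e1 : ee W (A - C - A) = ee W C + 1 := by
    have := ee_add hW (A - C - A) 1
    rw [← ee_refl hW (x := C) (y := A - C - A + 2 * W * 1) hC (by ring)] at this
    rw [this]; push_cast
    have two : ∀ a : ZMod 2, a = a + 1 + 1 := by decide
    exact two _
  have e2 : ee W (C - A) = ee W (A - C) + 1 := by
    have := ee_add hW (A - C) 1
    rw [← ee_refl hW (x := C - A) (y := A - C + 2 * W * 1) (hC.sub_even hA) (by ring)] at this
    simpa using this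
  rw [e1] at h2
  rw [e2] at h1
  have h3 : ell W A (A - C) = ell W A C := by rw [h1, h2]; ring
  unfold ell at h3
  by_cases a : ltI W A C <;> by_cases b : ltI W A (A - C) <;> simp_all

lemma par_II {W : ℤ} (hW : 0 < W) (hodd : Odd W) {h v u w r : ℤ} (hh : Even h) (hv : Even v)
    (hu : Odd u) (hr : Even r) (hw : u + w = h + v + r + 2 * W) :
    ell W h u + ell W h w + (ell W (h + 2 * r) (u + r) + ell W (h + 2 * r) (w + r)) +
    (ell W v u + ell W v w) + (ell W (v + 2 * r) (u + r) + ell W (v + 2 * r) (w + r)) = 0 := by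
  have hw' : w = h + v + r + 2 * W - u := by linarith
  have how : Odd w := by
    rw [hw']; exact (((hh.add hv).add hr).add (even_two_mul _)).sub_odd hu
  have h2r : Even (2 * r) := even_two_mul _
  rw [ell_eq hW hodd hh hu, ell_eq hW hodd hh how, ell_eq hW hodd hv hu, ell_eq hW hodd hv how,
    ell_eq hW hodd (hh.add h2r) (hu.add_even hr), ell_eq hW hodd (hh.add h2r) (how.add_even hr),
    ell_eq hW hodd (hv.add h2r) (hu.add_even hr), ell_eq hW hodd (hv.add h2r) (how.add_even hr)]
  rw [ee_refl hW (x := u - h) (y := w + r - (v + 2 * r)) (hu.sub_even hh) (by rw [hw']; ring),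
    ee_refl hW (x := u - v) (y := w + r - (h + 2 * r)) (hu.sub_even hv) (by rw [hw']; ring),
    ee_refl hW (x := w - h) (y := u + r - (v + 2 * r)) (how.sub_even hh) (by rw [hw']; ring),
    ee_refl hW (x := w - v) (y := u + r - (h + 2 * r)) (how.sub_even hv) (by rw [hw']; ring)]
  ring_nf
  simp [show (2 : ZMod 2) = 0 from rfl]

lemma par_I {W : ℤ} (hW : 0 < W) (hodd : Odd W) {h v u w r : ℤ} (hh : Even h) (hv : Even v)
    (hu : Odd u) (hr : Even r) (hw : u + w = h + v + r + 2 * W) :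
    ell W h w + ell W h (w + r) + (ell W (h + 2 * r) (w + r) + ell W (h + 2 * r) (w + 2 * r)) +
    (ell W v u + ell W v w) + (ell W (v + 2 * r) u + ell W (v + 2 * r) (w + 2 * r)) = 0 := by
  have hw' : w = h + v + r + 2 * W - u := by linarith
  have how : Odd w := by
    rw [hw']; exact (((hh.add hv).add hr).add (even_two_mul _)).sub_odd hu
  have h2r : Even (2 * r) := even_two_mul _
  rw [ell_eq hW hodd hh how, ell_eq hW hodd hh (how.add_even hr), ell_eq hW hodd hv hu,
    ell_eq hW hodd hv how,
    ell_eq hW hodd (hh.add h2r) (how.add_even hr), ell_eq hW hodd (hh.add h2r) (how.add_even h2r),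
    ell_eq hW hodd (hv.add h2r) hu, ell_eq hW hodd (hv.add h2r) (how.add_even h2r)]
  rw [ee_refl hW (x := w + r - h) (y := u - (v + 2 * r)) ((how.add_even hr).sub_even hh)
      (by rw [hw']; ring),
    ee_refl hW (x := u - v) (y := w + r - (h + 2 * r)) (hu.sub_even hv) (by rw [hw']; ring),
    show w + 2 * r - (h + 2 * r) = w - h by ring, show w + 2 * r - (v + 2 * r) = w - v by ring]
  ring_nf
  simp [show (2 : ZMod 2) = 0 from rfl]

/-! ### Counting light points -/

lemma ncard_one (S : Set ℤ) (R : ℤ → Prop) (N0 : ℤ) (h : ∀ N, N ∈ S ↔ (N = N0 ∧ R N)) :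
    S.ncard = if R N0 then 1 else 0 := by
  split_ifs with hR
  · have : S = {N0} := by
      ext N; rw [h]; simp only [Set.mem_singleton_iff]
      constructor
      · exact fun h => h.1
      · rintro rfl; exact ⟨rfl, hR⟩
    rw [this, Set.ncard_singleton]
  · have : S = ∅ := by
      ext N; rw [h]; simp only [Set.mem_empty_iff_false, iff_false]
      rintro ⟨rfl, h'⟩; exact hR h'
    rw [this, Set.ncard_empty]

lemma ncard_two (S : Set ℤ) (R : ℤ → Prop) (N0 N1 : ℤ) (hne : N0 ≠ N1)
    (h : ∀ N, N ∈ S ↔ ((N = N0 ∨ N = N1) ∧ R N)) :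
    S.ncard = (if R N0 then 1 else 0) + (if R N1 then 1 else 0) := by
  have hS : S = (S ∩ {N0}) ∪ (S ∩ {N1}) := by
    ext N
    simp only [Set.mem_union, Set.mem_inter_iff, Set.mem_singleton_iff]
    have := h N
    tauto
  have hd : Disjoint (S ∩ {N0}) (S ∩ {N1}) := by
    rw [Set.disjoint_left]
    rintro x ⟨_, hx⟩ ⟨_, hx'⟩
    exact hne (hx.symm.trans hx')
  rw [hS, Set.ncard_union_eq hd ((Set.finite_singleton _).inter_of_right _)
    ((Set.finite_singleton _).inter_of_right _)]
  congr 1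
  · apply ncard_one
    intro N; simp only [Set.mem_inter_iff, Set.mem_singleton_iff, h]; tauto
  · apply ncard_one
    intro N; simp only [Set.mem_inter_iff, Set.mem_singleton_iff, h]; tauto

/-- Transfer of a count of points on a horizontal segment to a count of intercepts. -/
lemma ncard_h (a b c s : ℝ) (hs : 0 < s) (R : ℤ → ℝ → Prop) :
    Set.ncard {x : ℝ | x ∈ Set.Icc a b ∧ ∃ N : ℤ, c + s * x = N ∧ R N x} =
    Set.ncard {N : ℤ | (c + s * a ≤ N ∧ N ≤ c + s * b) ∧ R N ((N - c) / s)} := by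
  have hinj : Function.Injective (fun N : ℤ => ((N : ℝ) - c) / s) := by
    intro N N' h
    simp only at h
    rw [div_left_inj' hs.ne'] at h
    exact_mod_cast (sub_left_inj.1 h)
  rw [← Set.ncard_image_of_injective _ hinj]
  congr 1
  ext x
  simp only [Set.mem_ofPred_eq, Set.mem_Icc, Set.mem_image]
  constructor
  · rintro ⟨⟨h1, h2⟩, N, hN, hR⟩
    have hx : ((N : ℝ) - c) / s = x := by rw [← hN]; field_simp; ring
    refine ⟨N, ⟨⟨?_, ?_⟩, ?_⟩, hx⟩
    · rw [← hN]; have := mul_le_mul_of_nonneg_left h1 hs.le; linarith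
    · rw [← hN]; have := mul_le_mul_of_nonneg_left h2 hs.le; linarith
    · rw [hx]; exact hR
  · rintro ⟨N, ⟨⟨h1, h2⟩, hR⟩, rfl⟩
    refine ⟨⟨?_, ?_⟩, N, ?_, hR⟩
    · rw [le_div_iff₀ hs]; linarith
    · rw [div_le_iff₀ hs]; linarith
    · field_simp; ring

namespace Param

variable (π : Param)

lemma q_eq : (π.q : ℤ) = π.ω - π.p := by unfold ω; push_cast; ring

lemma p_pos' : (0 : ℤ) < π.p := by exact_mod_cast π.p_pos

lemma two_p_lt : 2 * (π.p : ℤ) < π.ω := by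
  have := π.p_lt_q; unfold ω; push_cast; omega

lemma W_pos : (0 : ℤ) < π.ω := by have := π.two_p_lt; have := π.p_pos'; omega

lemma W_odd : Odd (π.ω : ℤ) := by
  have h := π.even_pq
  have hc := π.coprime
  rw [Nat.even_mul] at h
  have h2 : ¬ (Even π.p ∧ Even π.q) := by
    rintro ⟨a, b⟩
    have := Nat.dvd_gcd a.two_dvd b.two_dvd
    rw [hc] at this
    omega
  unfold ω
  rw [Nat.even_iff, Nat.even_iff] at *
  push_cast
  rw [Int.odd_iff]
  omega

lemma cop : IsCoprime (2 * (π.p : ℤ)) π.ω := by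
  apply IsCoprime.mul_left
  · rw [Int.isCoprime_iff_gcd_eq_one]
    have h := π.W_odd
    have : Odd π.ω := by exact_mod_cast h
    have := (Nat.coprime_two_left).2 this
    simpa [Int.gcd_eq_natAbs] using this
  · rw [Nat.isCoprime_iff_coprime]
    unfold ω
    simpa using π.coprime

lemma dvd_of_dvd {x : ℤ} (h : (π.ω : ℤ) ∣ 2 * π.p * x) : (π.ω : ℤ) ∣ x :=
  π.cop.symm.dvd_of_dvd_mul_left h

lemma ωR : (0 : ℝ) < π.ω := by exact_mod_cast π.W_pos
lemma P_pos : 0 < π.P := by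
  have := π.ωR
  have : (0 : ℝ) < π.p := by exact_mod_cast π.p_pos
  unfold P; positivity
lemma qR : (0 : ℝ) < π.q := by exact_mod_cast (π.p_pos.trans π.p_lt_q)
lemma Q_pos : 0 < π.Q := by
  have := π.ωR
  have := π.qR
  unfold Q; positivity

/-- The lightness of the line with intercept `N` on the grid line of index `a`. -/
def lt (a N : ℤ) : Prop := ltI π.ω (4 * π.p * a) (2 * π.p * N + π.ω)

lemma lt_iff (a N : ℤ) :
    lightPair (nrm (2 * π.P * a)) (nrm (π.P * N + 1)) ↔ π.lt a N := by
  unfold lt ltI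
  have h := π.ωR.ne'
  have e1 : 2 * π.P * a = ((4 * π.p * a : ℤ) : ℝ) / ((π.ω : ℤ) : ℝ) := by
    unfold P; push_cast; field_simp; ring
  have e2 : π.P * N + 1 = ((2 * π.p * N + π.ω : ℤ) : ℝ) / ((π.ω : ℤ) : ℝ) := by
    unfold P; push_cast; field_simp
  rw [e1, e2]

lemma lightHP_iff (x : ℝ) (n : ℤ) :
    π.lightHP (x, (n : ℝ)) ↔ ∃ N : ℤ, (n : ℝ) + π.P * x = N ∧ π.lt n N := by
  unfold lightHP onH onP FH FP
  constructor
  · rintro ⟨_, ⟨N, hN⟩, hl⟩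
    refine ⟨N, hN, ?_⟩
    rw [← lt_iff, ← hN]
    convert hl using 2; ring
  · rintro ⟨N, hN, hl⟩
    refine ⟨⟨n, rfl⟩, ⟨N, hN⟩, ?_⟩
    rw [← lt_iff, ← hN] at hl
    convert hl using 2; ring

lemma lightHQ_iff (x : ℝ) (n : ℤ) :
    π.lightHQ (x, (n : ℝ)) ↔ ∃ N : ℤ, (n : ℝ) + π.Q * x = N ∧ π.lt n N := by
  unfold lightHQ onH onQ FH FQ
  constructor
  · rintro ⟨_, ⟨N, hN⟩, hl⟩
    refine ⟨N, hN, ?_⟩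
    rw [← lt_iff, ← hN]
    convert hl using 2; ring
  · rintro ⟨N, hN, hl⟩
    refine ⟨⟨n, rfl⟩, ⟨N, hN⟩, ?_⟩
    rw [← lt_iff, ← hN] at hl
    convert hl using 2; ring

lemma lightVP_iff (y : ℝ) (m : ℤ) :
    π.lightVP ((m : ℝ), y) ↔ ∃ N : ℤ, π.P * m + 1 * y = N ∧ π.lt m N := by
  unfold lightVP onV onP FV FP
  constructor
  · rintro ⟨_, ⟨N, hN⟩, hl⟩
    have hN' : π.P * m + 1 * y = N := by rw [← hN]; ring
    refine ⟨N, hN', ?_⟩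
    rw [← lt_iff, ← hN]
    convert hl using 2; ring
  · rintro ⟨N, hN, hl⟩
    refine ⟨⟨m, rfl⟩, ⟨N, by rw [← hN]; ring⟩, ?_⟩
    rw [← lt_iff, ← hN] at hl
    convert hl using 2; ring

lemma lightVQ_iff (y : ℝ) (m : ℤ) :
    π.lightVQ ((m : ℝ), y) ↔ ∃ N : ℤ, π.Q * m + 1 * y = N ∧ π.lt m N := by
  unfold lightVQ onV onQ FV FQ
  constructor
  · rintro ⟨_, ⟨N, hN⟩, hl⟩
    have hN' : π.Q * m + 1 * y = N := by rw [← hN]; ring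
    refine ⟨N, hN', ?_⟩
    rw [← lt_iff, ← hN]
    convert hl using 2; ring
  · rintro ⟨N, hN, hl⟩
    refine ⟨⟨m, rfl⟩, ⟨N, by rw [← hN]; ring⟩, ?_⟩
    rw [← lt_iff, ← hN] at hl
    convert hl using 2; ring

lemma P_le (a b c : ℤ) : (a : ℝ) + π.P * b ≤ c ↔ 2 * π.p * b ≤ (c - a) * π.ω := by
  have h := π.ωR
  have : (a : ℝ) + π.P * b ≤ c ↔ (2 * π.p * b : ℝ) ≤ (c - a) * π.ω := by
    unfold P
    rw [← le_sub_iff_add_le', div_mul_eq_mul_div, div_le_iff₀ h]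
  rw [this]; exact_mod_cast Iff.rfl

lemma le_P (a b c : ℤ) : (c : ℝ) ≤ (a : ℝ) + π.P * b ↔ (c - a) * π.ω ≤ 2 * π.p * b := by
  have h := π.ωR
  have : (c : ℝ) ≤ (a : ℝ) + π.P * b ↔ (c - a) * π.ω ≤ (2 * π.p * b : ℝ) := by
    unfold P
    rw [← sub_le_iff_le_add', div_mul_eq_mul_div, le_div_iff₀ h]
  rw [this]; exact_mod_cast Iff.rfl

lemma Q_le (a b c : ℤ) : (a : ℝ) + π.Q * b ≤ c ↔ 2 * π.q * b ≤ (c - a) * π.ω := by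
  have h := π.ωR
  have : (a : ℝ) + π.Q * b ≤ c ↔ (2 * π.q * b : ℝ) ≤ (c - a) * π.ω := by
    unfold Q
    rw [← le_sub_iff_add_le', div_mul_eq_mul_div, div_le_iff₀ h]
  rw [this]; exact_mod_cast Iff.rfl

lemma le_Q (a b c : ℤ) : (c : ℝ) ≤ (a : ℝ) + π.Q * b ↔ (c - a) * π.ω ≤ 2 * π.q * b := by
  have h := π.ωR
  have : (c : ℝ) ≤ (a : ℝ) + π.Q * b ↔ (c - a) * π.ω ≤ (2 * π.q * b : ℝ) := by
    unfold Q
    rw [← sub_le_iff_le_add', div_mul_eq_mul_div, le_div_iff₀ h]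
  rw [this]; exact_mod_cast Iff.rfl

lemma vcount_sets (m n : ℤ) : π.vLightCount m n =
    Set.ncard {N : ℤ | (2 * π.p * m ≤ (N - n) * π.ω ∧ (N - n) * π.ω ≤ 2 * π.p * m + π.ω) ∧
      π.lt m N} +
    Set.ncard {N : ℤ | (2 * π.q * m ≤ (N - n) * π.ω ∧ (N - n) * π.ω ≤ 2 * π.q * m + π.ω) ∧
      π.lt m N} := by
  unfold vLightCount
  simp only [lightVP_iff, lightVQ_iff]
  rw [ncard_h _ _ _ 1 one_pos (fun N _ => π.lt m N), ncard_h _ _ _ 1 one_pos (fun N _ => π.lt m N)]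
  congr 2
  · ext N
    have h1 := π.P_le n m N
    have h2 := π.le_P (n + 1) m N
    push_cast at h2
    simp only [Set.mem_ofPred_eq]
    rw [show π.P * (m : ℝ) + 1 * n = n + π.P * m by ring,
      show π.P * (m : ℝ) + 1 * (n + 1) = n + 1 + π.P * m by ring, h1, h2,
      show (N - (n + 1)) * (π.ω : ℤ) ≤ 2 * π.p * m ↔ (N - n) * π.ω ≤ 2 * π.p * m + π.ω by
        constructor <;> intro h <;> linarith]
  · ext N
    have h1 := π.Q_le n m N
    have h2 := π.le_Q (n + 1) m N
    push_cast at h2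
    simp only [Set.mem_ofPred_eq]
    rw [show π.Q * (m : ℝ) + 1 * n = n + π.Q * m by ring,
      show π.Q * (m : ℝ) + 1 * (n + 1) = n + 1 + π.Q * m by ring, h1, h2,
      show (N - (n + 1)) * (π.ω : ℤ) ≤ 2 * π.q * m ↔ (N - n) * π.ω ≤ 2 * π.q * m + π.ω by
        constructor <;> intro h <;> linarith]

lemma onP_excl {m n l : ℤ} (hm0 : 0 ≤ m) (hm1 : m < π.ω)
    (h1 : 2 * π.q * m ≤ l * π.ω) (h2 : l * π.ω ≤ 2 * π.q * (m + 1)) :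
    (π.onP ((l : ℝ) / π.Q, (n : ℝ)) → (l : ℝ) / π.Q = (m : ℝ) + 1 / 2) ↔ l ≠ 0 ∧ l ≠ 2 * π.q := by
  have hω := π.ωR
  have hq := π.qR
  have hqi : (0 : ℤ) < π.q := by exact_mod_cast hq
  have hW := π.W_pos
  have ex : (l : ℝ) / π.Q = l * π.ω / (2 * π.q) := by unfold Q; field_simp
  rw [ex]
  unfold onP
  constructor
  · intro h
    constructor
    · rintro rfl
      have := h ⟨n, by simp⟩
      have h3 : ((0 : ℤ) : ℝ) = 2 * m + 1 := by push_cast at this ⊢; simp at this; linarith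
      have h4 : (0 : ℤ) = 2 * m + 1 := by exact_mod_cast h3
      omega
    · rintro rfl
      have e : (((2 * π.q : ℤ) : ℝ)) * π.ω / (2 * π.q) = π.ω := by push_cast; field_simp
      rw [e] at h
      have := h ⟨n + 2 * π.p, by unfold P; push_cast; field_simp⟩
      have h3 : (2 * (π.ω : ℤ) : ℝ) = 2 * m + 1 := by push_cast; linarith
      have h4 : 2 * (π.ω : ℤ) = 2 * m + 1 := by exact_mod_cast h3
      omega
  · rintro ⟨hl0, hl2⟩ ⟨N, hN⟩
    have e : (π.p : ℝ) * l = (N - n) * π.q := by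
      unfold P at hN
      simp only at hN
      field_simp at hN
      linarith
    have e' : (π.p : ℤ) * l = (N - n) * π.q := by exact_mod_cast e
    have hd : (π.q : ℤ) ∣ l := by
      have hc : IsCoprime (π.q : ℤ) π.p := by
        rw [Nat.isCoprime_iff_coprime]; exact π.coprime.symm
      exact hc.dvd_of_dvd_mul_left ⟨N - n, by rw [e']; ring⟩
    obtain ⟨t, rfl⟩ := hd
    have hlo : 0 ≤ t := by
      by_contra hcon
      have : t ≤ -1 := by omega
      nlinarith [mul_pos hqi hW, mul_nonneg hqi.le hm0]
    have hhi : t ≤ 2 := by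
      by_contra hcon
      have : 3 ≤ t := by omega
      nlinarith [mul_pos hqi hW, mul_le_mul_of_nonneg_left (show m + 1 ≤ π.ω by omega) hqi.le]
    have ht : t = 1 := by
      interval_cases t
      · simp at hl0
      · rfl
      · exact absurd (by ring) hl2
    subst ht
    have a1 : 2 * m ≤ π.ω := by nlinarith
    have a2 : (π.ω : ℤ) ≤ 2 * m + 2 := by nlinarith
    obtain ⟨r, hr⟩ := π.W_odd
    have a3 : (π.ω : ℤ) = 2 * m + 1 := by omega
    have a4 : (π.ω : ℝ) = 2 * m + 1 := by exact_mod_cast a3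
    push_cast
    rw [a4]; field_simp

lemma hcount_sets {m : ℤ} (n : ℤ) (hm0 : 0 ≤ m) (hm1 : m < π.ω) : π.hLightCount m n =
    Set.ncard {N : ℤ | (2 * π.p * m ≤ (N - n) * π.ω ∧ (N - n) * π.ω ≤ 2 * π.p * (m + 1)) ∧
      π.lt n N} +
    Set.ncard {N : ℤ | ((2 * π.q * m ≤ (N - n) * π.ω ∧ (N - n) * π.ω ≤ 2 * π.q * (m + 1)) ∧
      (N - n ≠ 0 ∧ N - n ≠ 2 * π.q)) ∧ π.lt n N} := by
  unfold hLightCount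
  simp only [lightHP_iff, lightHQ_iff]
  rw [ncard_h _ _ _ _ π.P_pos (fun N _ => π.lt n N)]
  have key := ncard_h (m : ℝ) (m + 1) n _ π.Q_pos
    (fun N x => π.lt n N ∧ (π.onP (x, (n : ℝ)) → x = (m : ℝ) + 1 / 2))
  have hh := π.P_le n m
  have hh' := π.le_P n (m + 1)
  have gg := π.Q_le n m
  have gg' := π.le_Q n (m + 1)
  push_cast at hh' gg'
  congr 1
  · simp only [hh, hh']
  · have e1 : {x : ℝ | x ∈ Set.Icc (m : ℝ) (m + 1) ∧
        (∃ N : ℤ, (n : ℝ) + π.Q * x = N ∧ π.lt n N) ∧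
        (π.onP (x, (n : ℝ)) → x = (m : ℝ) + 1 / 2)} =
        {x : ℝ | x ∈ Set.Icc (m : ℝ) (m + 1) ∧ ∃ N : ℤ, (n : ℝ) + π.Q * x = N ∧
        (π.lt n N ∧ (π.onP (x, (n : ℝ)) → x = (m : ℝ) + 1 / 2))} := by
      ext x
      simp only [Set.mem_ofPred_eq]
      constructor
      · rintro ⟨a, ⟨N, b, c⟩, d⟩; exact ⟨a, N, b, c, d⟩
      · rintro ⟨a, N, b, c, d⟩; exact ⟨a, ⟨N, b, c⟩, d⟩
    rw [e1, key]
    congr 1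
    ext N
    simp only [Set.mem_ofPred_eq, gg, gg']
    have := π.onP_excl (m := m) (n := n) (l := N - n) hm0 hm1
    push_cast at this
    constructor
    · rintro ⟨⟨a, b⟩, c, d⟩
      exact ⟨⟨⟨a, b⟩, (this a b).1 d⟩, c⟩
    · rintro ⟨⟨⟨a, b⟩, d⟩, c⟩
      exact ⟨⟨a, b⟩, c, (this a b).2 d⟩

lemma not_lt_zero' (N : ℤ) : ¬ π.lt 0 N := by
  have := ltI_zero π.W_pos 0 (2 * π.p * N + π.ω)
  unfold lt; simpa using this

lemma not_lt_W (N : ℤ) : ¬ π.lt π.ω N := by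
  have := ltI_zero π.W_pos (2 * π.p) (2 * π.p * N + π.ω)
  unfold lt
  rwa [show (4 * π.p * π.ω : ℤ) = 2 * π.ω * (2 * π.p) by ring]

lemma vcount_eq {m k : ℤ} (n : ℤ) (hm0 : 0 ≤ m) (hm1 : m ≤ π.ω)
    (hk1 : 2 * π.p * m ≤ k * π.ω) (hk2 : k * π.ω ≤ 2 * π.p * m + π.ω) :
    π.vLightCount m n = (if π.lt m (n + k) then 1 else 0) +
      (if π.lt m (n + 2 * m + 1 - k) then 1 else 0) := by
  rw [vcount_sets]
  rcases hm0.eq_or_lt with h | hm0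
  · subst h; simp [not_lt_zero']
  rcases hm1.eq_or_lt with h | hm1
  · subst h; simp [not_lt_W]
  have hW := π.W_pos
  have nd : ∀ t : ℤ, t * π.ω ≠ 2 * π.p * m := by
    intro t ht
    have := π.dvd_of_dvd (x := m) ⟨t, by rw [← ht]; ring⟩
    exact absurd (Int.le_of_dvd hm0 this) (by omega)
  have uniq : ∀ t : ℤ, (2 * π.p * m ≤ t * π.ω ∧ t * π.ω ≤ 2 * π.p * m + π.ω) ↔ t = k := by
    intro t
    constructor
    · rintro ⟨a, b⟩
      have n1 := nd t
      have n2 := nd k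
      have a' := lt_of_le_of_ne a n1.symm
      have b' := lt_of_le_of_ne hk1 n2.symm
      by_contra hne
      rcases lt_or_gt_of_ne hne with h | h <;> nlinarith
    · rintro rfl; exact ⟨hk1, hk2⟩
  congr 1
  · apply ncard_one
    intro N
    simp only [Set.mem_ofPred_eq]
    rw [uniq (N - n), sub_eq_iff_eq_add, add_comm]
  · apply ncard_one
    intro N
    simp only [Set.mem_ofPred_eq]
    have := uniq (2 * m + 1 - (N - n))
    have e : (2 * π.q * m ≤ (N - n) * π.ω ∧ (N - n) * π.ω ≤ 2 * π.q * m + π.ω) ↔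
        (2 * π.p * m ≤ (2 * m + 1 - (N - n)) * π.ω ∧
          (2 * m + 1 - (N - n)) * π.ω ≤ 2 * π.p * m + π.ω) := by
      rw [q_eq]
      constructor <;> rintro ⟨a, b⟩ <;> constructor <;> nlinarith
    rw [e, this]
    apply and_congr_left'
    omega

lemma hcount_II {m k : ℤ} (n : ℤ) (hm0 : 0 ≤ m) (hm1 : m < π.ω)
    (hk1 : 2 * π.p * m ≤ k * π.ω) (hk2 : k * π.ω ≤ 2 * π.p * (m + 1)) :
    π.hLightCount m n = (if π.lt n (n + k) then 1 else 0) +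
      (if π.lt n (n + 2 * m + 1 - k) then 1 else 0) := by
  rw [hcount_sets _ _ hm0 hm1]
  have hW := π.W_pos
  have hp := π.p_pos'
  have hpw := π.two_p_lt
  congr 1
  · apply ncard_one
    intro N
    simp only [Set.mem_ofPred_eq]
    apply and_congr_left'
    constructor
    · rintro ⟨a, b⟩
      by_contra hne
      rcases lt_or_gt_of_ne hne with h | h
      · have : N - n + 1 ≤ k := by omega
        nlinarith
      · have : k + 1 ≤ N - n := by omega
        nlinarith
    · rintro rfl
      rw [add_sub_cancel_left]; exact ⟨hk1, hk2⟩
  · apply ncard_one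
    intro N
    simp only [Set.mem_ofPred_eq]
    apply and_congr_left'
    rw [q_eq]
    constructor
    · rintro ⟨⟨a, b⟩, c, d⟩
      obtain ⟨i, hi⟩ : ∃ i, N - n = 2 * m - i := ⟨2 * m - (N - n), by ring⟩
      rw [hi] at a b c d
      have i1 : i ≤ k := by
        by_contra hcon
        have : k + 1 ≤ i := by omega
        nlinarith
      have i2 : i ≠ k := by
        rintro rfl
        have e : 2 * π.p * m = i * π.ω := le_antisymm hk1 (by nlinarith)
        have hd := π.dvd_of_dvd (x := m) ⟨i, by rw [e]; ring⟩
        have m0 : m = 0 := by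
          by_contra h0
          exact absurd (Int.le_of_dvd (by omega) hd) (by omega)
        subst m0
        have : i = 0 := by
          rcases mul_eq_zero.1 (show i * (π.ω : ℤ) = 0 by rw [← e]; ring) with h | h
          · exact h
          · omega
        omega
      have i3 : k - 2 ≤ i := by
        by_contra hcon
        have : i + 1 ≤ k - 2 := by omega
        nlinarith
      have i4 : i ≠ k - 2 := by
        rintro rfl
        have e : 2 * π.p * (m + 1) = k * π.ω := le_antisymm (by nlinarith) hk2
        have hd := π.dvd_of_dvd (x := m + 1) ⟨k, by rw [e]; ring⟩
        have m0 : m + 1 = π.ω := by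
          have := Int.le_of_dvd (by omega) hd
          omega
        rw [m0] at e
        have : k = 2 * π.p := by
          have := mul_right_cancel₀ hW.ne' e
          omega
        omega
      omega
    · rintro rfl
      have e : n + 2 * m + 1 - k - n = 2 * m + 1 - k := by ring
      rw [e]
      refine ⟨⟨by nlinarith, by nlinarith⟩, ?_, ?_⟩
      · intro h
        have : k = 2 * m + 1 := by omega
        subst this
        nlinarith
      · intro h
        have : k = 2 * m + 1 - 2 * (π.ω - π.p) := by omega
        subst this
        nlinarith [mul_pos (show 0 < (π.ω : ℤ) - m by omega) (show (0 : ℤ) < π.ω - 2 * π.p by omega),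
          mul_nonneg (show 0 ≤ (π.ω : ℤ) - m - 1 by omega) hW.le]

lemma hcount_I {m k : ℤ} (n : ℤ) (hm0 : 0 ≤ m) (hm1 : m < π.ω)
    (hk1 : 2 * π.p * (m + 1) < k * π.ω) (hk2 : k * π.ω < 2 * π.p * m + π.ω) :
    π.hLightCount m n = (if π.lt n (n + 2 * m + 1 - k) then 1 else 0) +
      (if π.lt n (n + 2 * m + 2 - k) then 1 else 0) := by
  rw [hcount_sets _ _ hm0 hm1]
  have hW := π.W_pos
  have hp := π.p_pos'
  have hpw := π.two_p_lt
  have z : {N : ℤ | (2 * π.p * m ≤ (N - n) * π.ω ∧ (N - n) * π.ω ≤ 2 * π.p * (m + 1)) ∧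
      π.lt n N} = ∅ := by
    ext N
    simp only [Set.mem_ofPred_eq, Set.mem_empty_iff_false, iff_false]
    rintro ⟨⟨a, b⟩, -⟩
    have h1 : N - n < k := by
      by_contra hcon
      have : k ≤ N - n := by omega
      nlinarith
    have : N - n + 1 ≤ k := by omega
    nlinarith
  rw [z, Set.ncard_empty, zero_add]
  apply ncard_two
  · omega
  intro N
  simp only [Set.mem_ofPred_eq]
  apply and_congr_left'
  have hqi : (0 : ℤ) < π.q := by exact_mod_cast π.qR
  have strict : ∀ l : ℤ, 2 * π.q * m < l * π.ω → l * π.ω < 2 * π.q * (m + 1) →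
      l ≠ 0 ∧ l ≠ 2 * π.q := by
    intro l a b
    constructor
    · rintro rfl; nlinarith
    · rintro rfl; nlinarith
  have key : ∀ l : ℤ, (l = 2 * m + 1 - k ∨ l = 2 * m + 2 - k) →
      2 * π.q * m < l * π.ω ∧ l * π.ω < 2 * π.q * (m + 1) := by
    intro l hl
    rw [q_eq]
    rcases hl with rfl | rfl <;> constructor <;> nlinarith
  constructor
  · rintro ⟨⟨a, b⟩, -⟩
    rw [q_eq] at a b
    obtain ⟨i, hi⟩ : ∃ i, N - n = 2 * m - i := ⟨2 * m - (N - n), by ring⟩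
    rw [hi] at a b
    have i1 : i < k := by
      by_contra hcon
      have : k ≤ i := by omega
      nlinarith
    have i2 : k - 3 < i := by
      by_contra hcon
      have : i ≤ k - 3 := by omega
      nlinarith
    omega
  · intro h
    obtain ⟨a, b⟩ := key (N - n) (by omega)
    exact ⟨⟨a.le, b.le⟩, strict _ a b⟩

/-! ### Parity of the number of good edges of a square -/

/-- Indicator of good horizontal edges. -/
def gH (m n : ℤ) : ZMod 2 := if π.goodH m n then 1 else 0

/-- Indicator of good vertical edges. -/
def gV (m n : ℤ) : ZMod 2 := if π.goodV m n then 1 else 0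

lemma gH_eq {m n : ℤ} {A B : Prop}
    (h : π.hLightCount m n = (if A then 1 else 0) + (if B then 1 else 0)) :
    π.gH m n = (if A then 1 else 0) + (if B then 1 else 0) := by
  unfold gH goodH
  by_cases a : A <;> by_cases b : B <;> simp [h, a, b]
  decide

lemma gV_eq {m n : ℤ} {A B : Prop}
    (h : π.vLightCount m n = (if A then 1 else 0) + (if B then 1 else 0)) :
    π.gV m n = (if A then 1 else 0) + (if B then 1 else 0) := by
  unfold gV goodV
  by_cases a : A <;> by_cases b : B <;> simp [h, a, b]
  decide

lemma exists_k (m : ℤ) : ∃ k : ℤ, 2 * π.p * m ≤ k * π.ω ∧ k * π.ω < 2 * π.p * m + π.ω := by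
  have hW := π.W_pos
  have h1 := Int.emod_nonneg (-(2 * π.p * m)) (b := π.ω) (by omega)
  have h2 := Int.emod_lt_of_pos (-(2 * π.p * m)) (b := π.ω) (by omega)
  have h3 := Int.emod_add_mul_ediv (-(2 * π.p * m)) π.ω
  exact ⟨-(-(2 * π.p * m) / π.ω), by linarith, by linarith⟩

lemma square (m n : ℤ) (hm0 : 0 ≤ m) (hm1 : m < π.ω) :
    π.gH m n + π.gH m (n + 1) + π.gV m n + π.gV (m + 1) n = 0 := by
  obtain ⟨k, hk1, hk2⟩ := π.exists_k m
  have hW := π.W_pos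
  have hp := π.p_pos'
  have hpw := π.two_p_lt
  have hodd := π.W_odd
  have ev4 : ∀ x : ℤ, Even (4 * π.p * x) := fun x => ⟨2 * π.p * x, by ring⟩
  have od : ∀ x : ℤ, Odd (2 * π.p * x + π.ω) := fun x =>
    Even.add_odd ⟨π.p * x, by ring⟩ hodd
  have L : ∀ a N A C : ℤ, 4 * π.p * a = A → 2 * π.p * N + π.ω = C →
      (if π.lt a N then (1 : ZMod 2) else 0) = ell π.ω A C := by
    rintro a N _ _ rfl rfl
    rfl
  rw [π.gV_eq (π.vcount_eq n hm0 hm1.le hk1 hk2.le)]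
  rcases le_or_gt (k * π.ω) (2 * π.p * (m + 1)) with h | h
  · rw [π.gH_eq (π.hcount_II n hm0 hm1 hk1 h),
      π.gH_eq (π.hcount_II (n + 1) hm0 hm1 hk1 h),
      π.gV_eq (π.vcount_eq (m := m + 1) (k := k + 1) n (by omega) (by omega)
        (by nlinarith) (by nlinarith))]
    have := par_II (W := π.ω) (h := 4 * π.p * n) (v := 4 * π.p * m) (u := 2 * π.p * (n + k) + π.ω)
      (w := 2 * π.p * (n + 2 * m + 1 - k) + π.ω) (r := 2 * π.p) hW hodd (ev4 _) (ev4 _) (od _)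
      (even_two_mul _) (by ring)
    rw [L (n) (n + k) (4 * π.p * n) (2 * π.p * (n + k) + π.ω) (by ring) (by ring),
      L (n) (n + 2 * m + 1 - k) (4 * π.p * n) (2 * π.p * (n + 2 * m + 1 - k) + π.ω) (by ring) (by ring),
      L (n + 1) (n + 1 + k) (4 * π.p * n + 2 * (2 * π.p)) (2 * π.p * (n + k) + π.ω + (2 * π.p)) (by ring) (by ring),
      L (n + 1) (n + 1 + 2 * m + 1 - k) (4 * π.p * n + 2 * (2 * π.p)) (2 * π.p * (n + 2 * m + 1 - k) + π.ω + (2 * π.p)) (by ring) (by ring),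
      L (m) (n + k) (4 * π.p * m) (2 * π.p * (n + k) + π.ω) (by ring) (by ring),
      L (m) (n + 2 * m + 1 - k) (4 * π.p * m) (2 * π.p * (n + 2 * m + 1 - k) + π.ω) (by ring) (by ring),
      L (m + 1) (n + (k + 1)) (4 * π.p * m + 2 * (2 * π.p)) (2 * π.p * (n + k) + π.ω + (2 * π.p)) (by ring) (by ring),
      L (m + 1) (n + 2 * (m + 1) + 1 - (k + 1)) (4 * π.p * m + 2 * (2 * π.p)) (2 * π.p * (n + 2 * m + 1 - k) + π.ω + (2 * π.p)) (by ring) (by ring)]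
    exact this
  · rw [π.gH_eq (π.hcount_I n hm0 hm1 h hk2),
      π.gH_eq (π.hcount_I (n + 1) hm0 hm1 h hk2),
      π.gV_eq (π.vcount_eq (m := m + 1) (k := k) n (by omega) (by omega)
        h.le (by nlinarith))]
    have := par_I (W := π.ω) (h := 4 * π.p * n) (v := 4 * π.p * m) (u := 2 * π.p * (n + k) + π.ω)
      (w := 2 * π.p * (n + 2 * m + 1 - k) + π.ω) (r := 2 * π.p) hW hodd (ev4 _) (ev4 _) (od _)
      (even_two_mul _) (by ring)
    rw [L (n) (n + 2 * m + 1 - k) (4 * π.p * n) (2 * π.p * (n + 2 * m + 1 - k) + π.ω) (by ring) (by ring),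
      L (n) (n + 2 * m + 2 - k) (4 * π.p * n) (2 * π.p * (n + 2 * m + 1 - k) + π.ω + (2 * π.p)) (by ring) (by ring),
      L (n + 1) (n + 1 + 2 * m + 1 - k) (4 * π.p * n + 2 * (2 * π.p)) (2 * π.p * (n + 2 * m + 1 - k) + π.ω + (2 * π.p)) (by ring) (by ring),
      L (n + 1) (n + 1 + 2 * m + 2 - k) (4 * π.p * n + 2 * (2 * π.p)) (2 * π.p * (n + 2 * m + 1 - k) + π.ω + 2 * (2 * π.p)) (by ring) (by ring),
      L (m) (n + k) (4 * π.p * m) (2 * π.p * (n + k) + π.ω) (by ring) (by ring),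
      L (m) (n + 2 * m + 1 - k) (4 * π.p * m) (2 * π.p * (n + 2 * m + 1 - k) + π.ω) (by ring) (by ring),
      L (m + 1) (n + k) (4 * π.p * m + 2 * (2 * π.p)) (2 * π.p * (n + k) + π.ω) (by ring) (by ring),
      L (m + 1) (n + 2 * (m + 1) + 1 - k) (4 * π.p * m + 2 * (2 * π.p)) (2 * π.p * (n + 2 * m + 1 - k) + π.ω + 2 * (2 * π.p)) (by ring) (by ring)]
    exact this

/-! ### Reflection symmetry -/

lemma lt_symmH (n j : ℤ) : π.lt (π.ω - n) (π.ω - n + j) ↔ π.lt n (n + j) := by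
  have hW := π.W_pos
  have hodd := π.W_odd
  have ev4 : Even (4 * π.p * n) := ⟨2 * π.p * n, by ring⟩
  have od : Odd (2 * π.p * (n + j) + π.ω) := Even.add_odd ⟨π.p * (n + j), by ring⟩ hodd
  unfold lt
  rw [show 4 * π.p * (π.ω - n) = -(4 * π.p * n) + 2 * π.ω * (2 * π.p : ℤ) by ring,
    show 2 * π.p * (π.ω - n + j) + π.ω = -(2 * π.p * (n - j) + π.ω) + 2 * π.ω * (π.p + 1 : ℤ) by ring,
    ltI_add hW, ltI_neg hW hodd ev4, ← ltI_sub hW hodd ev4 od,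
    ← ltI_add hW (4 * π.p * n) (4 * π.p * n - (2 * π.p * (n + j) + π.ω)) 0 1]
  rw [show 4 * π.p * n + 2 * π.ω * (0 : ℤ) = 4 * π.p * n by ring,
    show 4 * π.p * n - (2 * π.p * (n + j) + π.ω) + 2 * π.ω * (1 : ℤ) = 2 * π.p * (n - j) + π.ω by ring]

lemma lt_symmV (m n k : ℤ) : π.lt m (π.ω - 1 - n + k) ↔ π.lt m (n + 2 * m + 1 - k) := by
  have hW := π.W_pos
  have hodd := π.W_odd
  have ev4 : Even (4 * π.p * m) := ⟨2 * π.p * m, by ring⟩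
  have od : Odd (2 * π.p * (n + 2 * m + 1 - k) + π.ω) :=
    Even.add_odd ⟨π.p * (n + 2 * m + 1 - k), by ring⟩ hodd
  unfold lt
  rw [← ltI_sub hW hodd ev4 od, ← ltI_add hW (4 * π.p * m)
    (4 * π.p * m - (2 * π.p * (n + 2 * m + 1 - k) + π.ω)) 0 (π.p + 1)]
  rw [show 4 * π.p * m + 2 * π.ω * (0 : ℤ) = 4 * π.p * m by ring,
    show 4 * π.p * m - (2 * π.p * (n + 2 * m + 1 - k) + π.ω) + 2 * π.ω * (π.p + 1 : ℤ) =
      2 * π.p * (π.ω - 1 - n + k) + π.ω by ring]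

lemma goodH_symm {m : ℤ} (n : ℤ) (hm0 : 0 ≤ m) (hm1 : m < π.ω) (hg : π.goodH m n) :
    π.goodH m (π.ω - n) := by
  unfold goodH at *
  rw [← hg]
  obtain ⟨k, hk1, hk2⟩ := π.exists_k m
  have s1 := π.lt_symmH n k
  have s2 := π.lt_symmH n (2 * m + 1 - k)
  have s3 := π.lt_symmH n (2 * m + 2 - k)
  rcases le_or_gt (k * π.ω) (2 * π.p * (m + 1)) with h | h
  · rw [π.hcount_II n hm0 hm1 hk1 h, π.hcount_II _ hm0 hm1 hk1 h]
    rw [show (π.ω : ℤ) - n + 2 * m + 1 - k = π.ω - n + (2 * m + 1 - k) by ring,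
      show n + 2 * m + 1 - k = n + (2 * m + 1 - k) by ring]
    simp only [s1, s2]
  · rw [π.hcount_I n hm0 hm1 h hk2, π.hcount_I _ hm0 hm1 h hk2]
    rw [show (π.ω : ℤ) - n + 2 * m + 1 - k = π.ω - n + (2 * m + 1 - k) by ring,
      show n + 2 * m + 1 - k = n + (2 * m + 1 - k) by ring,
      show (π.ω : ℤ) - n + 2 * m + 2 - k = π.ω - n + (2 * m + 2 - k) by ring,
      show n + 2 * m + 2 - k = n + (2 * m + 2 - k) by ring]
    simp only [s2, s3]

lemma goodV_symm {m : ℤ} (n : ℤ) (hm0 : 0 ≤ m) (hm1 : m ≤ π.ω) (hg : π.goodV m n) :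
    π.goodV m (π.ω - 1 - n) := by
  unfold goodV at *
  rw [← hg]
  obtain ⟨k, hk1, hk2⟩ := π.exists_k m
  have s1 := π.lt_symmV m n k
  have s2 := π.lt_symmV m n (2 * m + 1 - k)
  rw [π.vcount_eq n hm0 hm1 hk1 hk2.le, π.vcount_eq _ hm0 hm1 hk1 hk2.le]
  rw [show (π.ω : ℤ) - 1 - n + 2 * m + 1 - k = π.ω - 1 - n + (2 * m + 1 - k) by ring]
  rw [show n + 2 * m + 1 - (2 * m + 1 - k) = n + k by ring] at s2
  simp only [s1, s2]
  exact add_comm _ _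

/-! ### No good edges on the boundary lines of the block -/

lemma not_goodV (a : ℤ) (h : ∀ N, ¬ π.lt a N) (n : ℤ) : ¬ π.goodV a n := by
  unfold goodV
  rw [vcount_sets]
  simp [h]

lemma not_goodH (b : ℤ) (h : ∀ N, ¬ π.lt b N) (m : ℤ) : ¬ π.goodH m b := by
  unfold goodH hLightCount
  simp [lightHP_iff, lightHQ_iff, h]

/-! ### Grid lines of capacity two -/

lemma rp_small {W x : ℤ} (hW : 0 < W) (h1 : -W ≤ x) (h2 : x < W) : rp W x = x := by
  unfold rp
  rw [Int.ediv_eq_zero_of_lt (by omega) (by omega)]; ring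

lemma lt_cap {n0 ε : ℤ} (hε : ε = 1 ∨ ε = -1) (hn : (π.ω : ℤ) ∣ 2 * π.p * n0 - ε) (N : ℤ) :
    π.lt n0 N ↔ (π.ω : ℤ) ∣ N - n0 := by
  have hW := π.W_pos
  have hp := π.p_pos'
  have hpw := π.two_p_lt
  have hodd := π.W_odd
  unfold lt
  rw [ltI_iff hW]
  have hA : rp π.ω (4 * π.p * n0) = 2 * ε := by
    obtain ⟨t, ht⟩ := hn
    rw [show 4 * π.p * n0 = 2 * ε + 2 * π.ω * t by linarith, rp_add hW]
    apply rp_small hW <;> omega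
  rw [hA]
  have pc : Odd (rp π.ω (2 * π.p * N + π.ω)) := by
    unfold rp
    exact (Even.add_odd ⟨π.p * N, by ring⟩ hodd).sub_even (by rw [mul_assoc]; exact even_two_mul _)
  have e1 : ((0 < rp π.ω (2 * π.p * N + π.ω) ∧ rp π.ω (2 * π.p * N + π.ω) < 2 * ε) ∨
      (2 * ε < rp π.ω (2 * π.p * N + π.ω) ∧ rp π.ω (2 * π.p * N + π.ω) < 0)) ↔
      rp π.ω (2 * π.p * N + π.ω) = ε := by
    generalize rp π.ω (2 * π.p * N + π.ω) = c
    omega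
  rw [e1]
  constructor
  · intro h
    unfold rp at h
    apply π.dvd_of_dvd
    obtain ⟨t, ht⟩ := hn
    exact ⟨2 * ((2 * π.p * N + π.ω + π.ω) / (2 * π.ω)) - 1 - t, by linarith⟩
  · intro h
    have hd : (π.ω : ℤ) ∣ 2 * π.p * N + π.ω - ε := by
      obtain ⟨x, hx⟩ := h
      obtain ⟨t, ht⟩ := hn
      exact ⟨2 * π.p * x + t + 1, by linear_combination (2 * (π.p : ℤ)) * hx + ht⟩
    have h2 : (2 : ℤ) ∣ 2 * π.p * N + π.ω - ε := by
      obtain ⟨r, hr⟩ := hodd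
      rw [hr, mul_assoc]
      omega
    have hc : IsCoprime (2 : ℤ) π.ω := (π.cop).of_mul_left_left
    obtain ⟨s, hs⟩ := hc.mul_dvd h2 hd
    rw [show 2 * π.p * N + (π.ω : ℤ) = ε + 2 * π.ω * s by linarith, rp_add hW]
    apply rp_small hW <;> omega

lemma exists_cap : ∃ n0 ε : ℤ, (ε = 1 ∨ ε = -1) ∧ (π.ω : ℤ) ∣ 2 * π.p * n0 - ε ∧
    0 < n0 ∧ 2 * n0 < π.ω := by
  have hW := π.W_pos
  have hp := π.p_pos'
  have hpw := π.two_p_lt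
  obtain ⟨a, b, hab⟩ := π.cop
  have h1 := Int.emod_nonneg a (b := π.ω) (by omega)
  have h2 := Int.emod_lt_of_pos a (b := π.ω) (by omega)
  have h3 := Int.emod_add_mul_ediv a π.ω
  generalize a % (π.ω : ℤ) = n1 at *
  generalize a / (π.ω : ℤ) = t at *
  have hd : (π.ω : ℤ) ∣ 2 * π.p * n1 - 1 := ⟨-b - 2 * π.p * t, by rw [← hab, ← h3]; ring⟩
  have hne : n1 ≠ 0 := by
    rintro rfl
    have : (π.ω : ℤ) ∣ 1 := by
      have := hd.neg_right
      simpa using this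
    have := Int.le_of_dvd one_pos this
    omega
  obtain ⟨r, hr⟩ := π.W_odd
  by_cases hlt : 2 * n1 < π.ω
  · exact ⟨n1, 1, Or.inl rfl, hd, by omega, hlt⟩
  · refine ⟨π.ω - n1, -1, Or.inr rfl, ?_, by omega, by omega⟩
    obtain ⟨s, hs⟩ := hd
    exact ⟨2 * π.p - s, by linarith⟩

lemma goodH_cap_zero {n0 : ℤ} (hc : ∀ N, π.lt n0 N ↔ (π.ω : ℤ) ∣ N - n0) : π.goodH 0 n0 := by
  have hW := π.W_pos
  have hp := π.p_pos'
  have hpw := π.two_p_lt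
  unfold goodH
  rw [π.hcount_II (k := 0) n0 le_rfl hW (by simp) (by simp)]
  simp only [hc]
  rw [if_pos (by simp), if_neg]
  intro h
  have : (π.ω : ℤ) ∣ 1 := by simpa using h
  have := Int.le_of_dvd one_pos this
  omega

lemma goodH_cap {n0 m : ℤ} (hc : ∀ N, π.lt n0 N ↔ (π.ω : ℤ) ∣ N - n0) (hm0 : 0 < m)
    (hm1 : m < π.ω) (hg : π.goodH m n0) : (π.ω : ℤ) * π.ω ≤ 2 * π.q * (m + 1) := by
  have hW := π.W_pos
  have hp := π.p_pos'
  have hpw := π.two_p_lt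
  have hqi : (0 : ℤ) < π.q := by exact_mod_cast π.qR
  have big : ∀ l r : ℤ, 0 < r → 2 * r * m ≤ l * π.ω → (π.ω : ℤ) ∣ l → (π.ω : ℤ) ≤ l := by
    intro l r hr h hd
    apply Int.le_of_dvd _ hd
    by_contra hcon
    have : l ≤ 0 := by omega
    nlinarith [mul_pos hr hm0]
  unfold goodH at hg
  rw [hcount_sets _ _ hm0.le hm1] at hg
  simp only [hc] at hg
  by_contra hcon
  push Not at hcon
  rw [show {N : ℤ | (2 * (π.p : ℤ) * m ≤ (N - n0) * π.ω ∧ (N - n0) * π.ω ≤ 2 * π.p * (m + 1)) ∧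
      (π.ω : ℤ) ∣ N - n0} = ∅ from ?_, show {N : ℤ | ((2 * (π.q : ℤ) * m ≤ (N - n0) * π.ω ∧
      (N - n0) * π.ω ≤ 2 * π.q * (m + 1)) ∧ (N - n0 ≠ 0 ∧ N - n0 ≠ 2 * π.q)) ∧
      (π.ω : ℤ) ∣ N - n0} = ∅ from ?_] at hg
  · simp at hg
  · ext N
    simp only [Set.mem_ofPred_eq, Set.mem_empty_iff_false, iff_false]
    rintro ⟨⟨⟨a, b⟩, -⟩, c⟩
    have := big _ _ hqi a c
    nlinarith
  · ext N
    simp only [Set.mem_ofPred_eq, Set.mem_empty_iff_false, iff_false]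
    rintro ⟨⟨a, b⟩, c⟩
    have := big _ _ hp a c
    nlinarith

lemma goodV_cap {n0 b b' : ℤ} (hc : ∀ N, π.lt n0 N ↔ (π.ω : ℤ) ∣ N - n0) (hn0 : 0 ≤ n0)
    (hn1 : n0 ≤ π.ω) (hb : 0 ≤ b) (hbW : b < π.ω) (hb' : 0 ≤ b') (hbW' : b' < π.ω) (hne : b ≠ b')
    (hg : π.goodV n0 b) (hg' : π.goodV n0 b') : b' = π.ω - 1 - b := by
  obtain ⟨k, hk1, hk2⟩ := π.exists_k n0
  unfold goodV at hg hg'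
  rw [π.vcount_eq _ hn0 hn1 hk1 hk2.le] at hg hg'
  simp only [hc] at hg hg'
  have small : ∀ x : ℤ, (π.ω : ℤ) ∣ x → -π.ω < x → x < π.ω → x = 0 := by
    intro x hx h1 h2
    exact Int.eq_zero_of_abs_lt_dvd hx (abs_lt.2 ⟨h1, h2⟩)
  have d1 : (π.ω : ℤ) ∣ b + k - n0 ∨ (π.ω : ℤ) ∣ b + 2 * n0 + 1 - k - n0 := by
    by_contra hcon
    push Not at hcon
    rw [if_neg hcon.1, if_neg hcon.2] at hg
    omega
  have d2 : (π.ω : ℤ) ∣ b' + k - n0 ∨ (π.ω : ℤ) ∣ b' + 2 * n0 + 1 - k - n0 := by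
    by_contra hcon
    push Not at hcon
    rw [if_neg hcon.1, if_neg hcon.2] at hg'
    omega
  rcases d1 with ⟨x, hx⟩ | ⟨x, hx⟩ <;> rcases d2 with ⟨y, hy⟩ | ⟨y, hy⟩
  · have := small (b - b') ⟨x - y, by linear_combination hx - hy⟩ (by omega) (by omega)
    omega
  · have := small (b + b' + 1 - π.ω)
      ⟨x + y - 1, by linear_combination hx + hy⟩ (by omega) (by omega)
    omega
  · have := small (b + b' + 1 - π.ω)
      ⟨x + y - 1, by linear_combination hx + hy⟩ (by omega) (by omega)
    omega
  · have := small (b - b') ⟨x - y, by linear_combination hx - hy⟩ (by omega) (by omega)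
    omega

/-! ### The cut lemma -/

lemma cut (W : ℕ) (g g' s : ℤ → ℤ → ZMod 2)
    (sq : ∀ m n : ℤ, 0 ≤ m → m < W → 0 ≤ n → n < W →
      g m n + g m (n + 1) + g' m n + g' (m + 1) n = 0)
    (hH : ∀ m n : ℤ, g m (n + 1) * s m n = g m (n + 1) * s m (n + 1))
    (hV : ∀ m n : ℤ, g' (m + 1) n * s m n = g' (m + 1) n * s (m + 1) n)
    (b0 : ∀ n, g' 0 n = 0) (bW : ∀ n, g' W n = 0) (h0 : ∀ m, g m 0 = 0) (n : ℕ) (hn : n ≤ W) :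
    ∑ m ∈ Finset.range W, g m n * s m n = 0 := by
  induction n with
  | zero => simp [h0]
  | succ n ih =>
    have ih' := ih (by omega)
    have tel : ∑ m ∈ Finset.range W, (g' ((m + 1 : ℕ) : ℤ) n * s ((m + 1 : ℕ) : ℤ) n -
        g' (m : ℤ) n * s (m : ℤ) n) = 0 := by
      rw [Finset.sum_range_sub (fun m : ℕ => g' (m : ℤ) n * s (m : ℤ) n)]
      simp [b0, bW]
    have tot : ∑ m ∈ Finset.range W, (g m n * s m n + g m ((n + 1 : ℕ) : ℤ) * s m ((n + 1 : ℕ) : ℤ) +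
        (g' ((m + 1 : ℕ) : ℤ) n * s ((m + 1 : ℕ) : ℤ) n - g' (m : ℤ) n * s (m : ℤ) n)) = 0 := by
      apply Finset.sum_eq_zero
      intro m hm
      rw [Finset.mem_range] at hm
      have e := sq m n (by omega) (by omega) (by omega) (by omega)
      push_cast
      rw [← hH, ← hV, CharTwo.sub_eq_add]
      calc _ = (g m n + g m (n + 1) + g' m n + g' (m + 1) n) * s m n := by ring
        _ = 0 := by rw [e, zero_mul]
    rw [Finset.sum_add_distrib, Finset.sum_add_distrib, tel, ih'] at tot
    simpa using tot

lemma exists_other (W : ℕ) (f : ℕ → ZMod 2) (h : ∑ m ∈ Finset.range W, f m = 0) (i : ℕ)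
    (hi : i < W) (hf : f i ≠ 0) : ∃ j < W, j ≠ i ∧ f j ≠ 0 := by
  by_contra hcon
  push Not at hcon
  rw [Finset.sum_eq_single_of_mem i (Finset.mem_range.2 hi)
    (fun b hb hne => hcon b (Finset.mem_range.1 hb) hne)] at h
  exact hf h

/-! ### Topology -/

/-- Center of a square. -/
def ctr (m n : ℤ) : ℝ × ℝ := ((m : ℝ) + 1 / 2, (n : ℝ) + 1 / 2)

lemma cc_iff {S : Set (ℝ × ℝ)} {a b z : ℝ × ℝ} (h : segment ℝ a b ⊆ S) :
    a ∈ connectedComponentIn S z ↔ b ∈ connectedComponentIn S z := by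
  have hc : IsPreconnected (segment ℝ a b) := (convex_segment a b).isPreconnected
  constructor
  · intro ha
    rw [connectedComponentIn_eq ha]
    exact hc.subset_connectedComponentIn (left_mem_segment ℝ a b) h (right_mem_segment ℝ a b)
  · intro hb
    rw [connectedComponentIn_eq hb]
    exact hc.subset_connectedComponentIn (right_mem_segment ℝ a b) h (left_mem_segment ℝ a b)

lemma edgeV {a b : ℤ} (h : π.goodV a b) (z : ℝ × ℝ) :
    (ctr a b ∈ connectedComponentIn π.plaidSet z ↔
      ((a : ℝ), (b : ℝ) + 1 / 2) ∈ connectedComponentIn π.plaidSet z) :=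
  cc_iff (fun w hw => ⟨a, b, Or.inr (Or.inr (Or.inl ⟨h, hw⟩))⟩)

lemma edgeV' {a b : ℤ} (h : π.goodV (a + 1) b) (z : ℝ × ℝ) :
    (ctr a b ∈ connectedComponentIn π.plaidSet z ↔
      ((a : ℝ) + 1, (b : ℝ) + 1 / 2) ∈ connectedComponentIn π.plaidSet z) :=
  cc_iff (fun w hw => ⟨a, b, Or.inr (Or.inr (Or.inr ⟨h, hw⟩))⟩)

lemma edgeH {a b : ℤ} (h : π.goodH a b) (z : ℝ × ℝ) :
    (ctr a b ∈ connectedComponentIn π.plaidSet z ↔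
      ((a : ℝ) + 1 / 2, (b : ℝ)) ∈ connectedComponentIn π.plaidSet z) :=
  cc_iff (fun w hw => ⟨a, b, Or.inl ⟨h, hw⟩⟩)

lemma edgeH' {a b : ℤ} (h : π.goodH a (b + 1)) (z : ℝ × ℝ) :
    (ctr a b ∈ connectedComponentIn π.plaidSet z ↔
      ((a : ℝ) + 1 / 2, (b : ℝ) + 1) ∈ connectedComponentIn π.plaidSet z) :=
  cc_iff (fun w hw => ⟨a, b, Or.inr (Or.inl ⟨h, hw⟩)⟩)

lemma half_int {a m : ℤ} {s : ℝ} (h : (a : ℝ) = m + s) (h0 : 0 ≤ s) (h1 : s < 1) : a = m := by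
  have h2 : (a : ℝ) < m + 1 := by linarith
  have h3 : (m : ℝ) ≤ a := by linarith
  have h2' : a < m + 1 := by exact_mod_cast h2
  have h3' : m ≤ a := by exact_mod_cast h3
  omega

lemma plaid_x_int {z : ℝ × ℝ} (hz : z ∈ π.plaidSet) {a : ℤ} (ha : z.1 = a) :
    ∃ b : ℤ, π.goodV a b ∧ z = ((a : ℝ), (b : ℝ) + 1 / 2) := by
  obtain ⟨m, n, h⟩ := hz
  rcases h with ⟨hg, s, t, hs, ht, hst, rfl⟩ | ⟨hg, s, t, hs, ht, hst, rfl⟩ |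
    ⟨hg, s, t, hs, ht, hst, rfl⟩ | ⟨hg, s, t, hs, ht, hst, rfl⟩ <;>
    simp only [Prod.smul_mk, Prod.mk_add_mk, smul_eq_mul] at ha ⊢ <;>
    obtain rfl : t = 1 - s := by linarith
  · have e : (a : ℝ) = m + 1 / 2 := by rw [← ha]; ring
    have := half_int e (by norm_num) (by norm_num)
    subst this; norm_num at e
  · have e : (a : ℝ) = m + 1 / 2 := by rw [← ha]; ring
    have := half_int e (by norm_num) (by norm_num)
    subst this; norm_num at e
  · have e : (a : ℝ) = m + s / 2 := by rw [← ha]; ring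
    have := half_int e (by linarith) (by linarith)
    subst this
    exact ⟨n, hg, Prod.ext (by simpa using ha) (by simp only; ring)⟩
  · have e : ((m + 1 : ℤ) : ℝ) = a + s / 2 := by rw [← ha]; push_cast; ring
    have := half_int e (by linarith) (by linarith)
    subst this
    exact ⟨n, hg, Prod.ext (by simpa using ha) (by simp only; ring)⟩

lemma plaid_y_int {z : ℝ × ℝ} (hz : z ∈ π.plaidSet) {a : ℤ} (ha : z.2 = a) :
    ∃ m : ℤ, π.goodH m a := by
  obtain ⟨m, n, h⟩ := hz
  rcases h with ⟨hg, s, t, hs, ht, hst, rfl⟩ | ⟨hg, s, t, hs, ht, hst, rfl⟩ |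
    ⟨hg, s, t, hs, ht, hst, rfl⟩ | ⟨hg, s, t, hs, ht, hst, rfl⟩ <;>
    simp only [Prod.smul_mk, Prod.mk_add_mk, smul_eq_mul] at ha ⊢ <;>
    obtain rfl : t = 1 - s := by linarith
  · have e : (a : ℝ) = n + s / 2 := by rw [← ha]; ring
    have := half_int e (by linarith) (by linarith)
    subst this
    exact ⟨m, hg⟩
  · have e : ((n + 1 : ℤ) : ℝ) = a + s / 2 := by rw [← ha]; push_cast; ring
    have := half_int e (by linarith) (by linarith)
    subst this
    exact ⟨m, hg⟩
  · have e : (a : ℝ) = n + 1 / 2 := by rw [← ha]; ring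
    have := half_int e (by norm_num) (by norm_num)
    subst this; norm_num at e
  · have e : (a : ℝ) = n + 1 / 2 := by rw [← ha]; ring
    have := half_int e (by norm_num) (by norm_num)
    subst this; norm_num at e

lemma plaid_refl {z : ℝ × ℝ} (hz : z ∈ π.plaidSet) (h0 : 0 < z.1) (h1 : z.1 < π.ω) :
    (z.1, (π.ω : ℝ) - z.2) ∈ π.plaidSet := by
  obtain ⟨m, n, h⟩ := hz
  have bound : ∀ x : ℝ, 0 < x → x < π.ω → (m : ℝ) ≤ x → x ≤ m + 1 → 0 ≤ m ∧ m < π.ω := by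
    intro x a b c d
    have e1 : (-1 : ℝ) < m := by linarith
    have e2 : (m : ℝ) < π.ω := by linarith
    have e1' : -1 < m := by exact_mod_cast e1
    have e2' : m < (π.ω : ℤ) := by exact_mod_cast e2
    omega
  refine ⟨m, π.ω - 1 - n, ?_⟩
  rcases h with ⟨hg, s, t, hs, ht, hst, rfl⟩ | ⟨hg, s, t, hs, ht, hst, rfl⟩ |
    ⟨hg, s, t, hs, ht, hst, rfl⟩ | ⟨hg, s, t, hs, ht, hst, rfl⟩ <;>
    simp only [Prod.smul_mk, Prod.mk_add_mk, smul_eq_mul] at h0 h1 ⊢ <;>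
    obtain rfl : t = 1 - s := by linarith
  · obtain ⟨b0, b1⟩ := bound _ h0 h1 (by linarith) (by linarith)
    refine Or.inr (Or.inl ⟨?_, s, 1 - s, hs, ht, hst, ?_⟩)
    · have := π.goodH_symm n b0 b1 hg
      rwa [show (π.ω : ℤ) - 1 - n + 1 = π.ω - n by ring]
    · ext <;> simp <;> ring
  · obtain ⟨b0, b1⟩ := bound _ h0 h1 (by linarith) (by linarith)
    refine Or.inl ⟨?_, s, 1 - s, hs, ht, hst, ?_⟩
    · have := π.goodH_symm (n + 1) b0 b1 hg
      rwa [show (π.ω : ℤ) - 1 - n = π.ω - (n + 1) by ring]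
    · ext <;> simp <;> ring
  · obtain ⟨b0, b1⟩ := bound _ h0 h1 (by linarith) (by linarith)
    refine Or.inr (Or.inr (Or.inl ⟨π.goodV_symm n b0 b1.le hg, s, 1 - s, hs, ht, hst, ?_⟩))
    ext <;> simp <;> ring
  · obtain ⟨b0, b1⟩ := bound _ h0 h1 (by linarith) (by linarith)
    refine Or.inr (Or.inr (Or.inr ⟨π.goodV_symm n (by omega) (by omega) hg,
      s, 1 - s, hs, ht, hst, ?_⟩))
    ext <;> simp <;> ring

lemma avoid {I : Set ℝ} (hI : IsPreconnected I) {x a b : ℝ} (hx : x ∈ I) (ha : a ∉ I) (hb : b ∉ I)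
    (h1 : a < x) (h2 : x < b) : I ⊆ Set.Ioo a b := by
  have ho := hI.ordConnected
  intro y hy
  constructor
  · by_contra hcon
    exact ha (ho.out hy hx ⟨not_lt.1 hcon, h1.le⟩)
  · by_contra hcon
    exact hb (ho.out hx hy ⟨h2.le, not_lt.1 hcon⟩)

end Param

/-- There exists a plaid polygon `Γ` contained in the first block `[0,ω]²` whose `x`-diameter
(the diameter of its orthogonal projection to the `x`-axis) is at least `ω²/(2q) - 1`;
moreover `Γ` is invariant under reflection in the horizontal midline `y = ω/2` of the block. -/
theorem one_big_polygon (π : Param) :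
    ∃ Γ : Set (ℝ × ℝ), π.IsPlaidPolygon Γ ∧
      Γ ⊆ Set.Icc ((0 : ℝ), (0 : ℝ)) ((π.ω : ℝ), (π.ω : ℝ)) ∧
      (π.ω : ℝ) ^ 2 / (2 * π.q) - 1 ≤ Metric.diam (Prod.fst '' Γ) ∧
      (∀ z ∈ Γ, (z.1, (π.ω : ℝ) - z.2) ∈ Γ) := by
  have hW := π.W_pos
  have hp := π.p_pos'
  have hpw := π.two_p_lt
  have hωR := π.ωR
  have hqR := π.qR
  obtain ⟨n0, ε, hε, hd, hn0, hn1⟩ := π.exists_cap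
  have hc := π.lt_cap hε hd
  have hg0 := π.goodH_cap_zero hc
  have hz : Param.ctr 0 n0 ∈ π.plaidSet :=
    ⟨0, n0, Or.inl ⟨hg0, left_mem_segment ℝ _ _⟩⟩
  obtain ⟨Γ, hΓ⟩ : ∃ Γ, Γ = connectedComponentIn π.plaidSet (Param.ctr 0 n0) := ⟨_, rfl⟩
  have hzΓ : Param.ctr 0 n0 ∈ Γ := by rw [hΓ]; exact mem_connectedComponentIn hz
  have hpre : IsPreconnected Γ := by rw [hΓ]; exact isPreconnected_connectedComponentIn
  have hsub : Γ ⊆ π.plaidSet := by rw [hΓ]; exact connectedComponentIn_subset _ _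
  have hprex : IsPreconnected (Prod.fst '' Γ) := hpre.image _ continuous_fst.continuousOn
  have hprey : IsPreconnected (Prod.snd '' Γ) := hpre.image _ continuous_snd.continuousOn
  have nV0 : ∀ n, ¬ π.goodV 0 n := π.not_goodV 0 π.not_lt_zero'
  have nVW : ∀ n, ¬ π.goodV π.ω n := π.not_goodV _ π.not_lt_W
  have nH0 : ∀ m, ¬ π.goodH m 0 := π.not_goodH 0 π.not_lt_zero'
  have nHW : ∀ m, ¬ π.goodH m π.ω := π.not_goodH _ π.not_lt_W
  -- the component stays in the open block
  have hn0R : (0 : ℝ) < n0 := by exact_mod_cast hn0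
  have hn1R : (2 : ℝ) * n0 < π.ω := by exact_mod_cast hn1
  have hω1 : (1 : ℝ) < π.ω := by
    have : (1 : ℤ) < π.ω := by omega
    exact_mod_cast this
  have hx : Prod.fst '' Γ ⊆ Set.Ioo 0 (π.ω : ℝ) := by
    apply Param.avoid hprex (x := 1 / 2) ⟨_, hzΓ, by simp [Param.ctr]⟩
    · rintro ⟨z, hzz, h⟩
      obtain ⟨b, hb, -⟩ := π.plaid_x_int (hsub hzz) (a := 0) (by simpa using h)
      exact nV0 b hb
    · rintro ⟨z, hzz, h⟩
      obtain ⟨b, hb, -⟩ := π.plaid_x_int (hsub hzz) (a := π.ω) (by simpa using h)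
      exact nVW b hb
    · norm_num
    · linarith
  have hy : Prod.snd '' Γ ⊆ Set.Ioo 0 (π.ω : ℝ) := by
    apply Param.avoid hprey (x := n0 + 1 / 2) ⟨_, hzΓ, by simp [Param.ctr]⟩
    · rintro ⟨z, hzz, h⟩
      obtain ⟨b, hb⟩ := π.plaid_y_int (hsub hzz) (a := 0) (by simpa using h)
      exact nH0 b hb
    · rintro ⟨z, hzz, h⟩
      obtain ⟨b, hb⟩ := π.plaid_y_int (hsub hzz) (a := π.ω) (by simpa using h)
      exact nHW b hb
    · linarith
    · have h1 : 2 * n0 + 1 ≤ (π.ω : ℤ) := by omega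
      have h2 : 2 * (n0 : ℝ) + 1 ≤ π.ω := by exact_mod_cast h1
      have h3 : (1 : ℝ) ≤ n0 := by exact_mod_cast hn0
      linarith
  -- the indicator of the component
  obtain ⟨s, hs⟩ : ∃ s : ℤ → ℤ → ZMod 2, ∀ m n, s m n = if Param.ctr m n ∈ Γ then 1 else 0 :=
    ⟨_, fun _ _ => rfl⟩
  have sH : ∀ m n : ℤ, π.gH m (n + 1) * s m n = π.gH m (n + 1) * s m (n + 1) := by
    intro m n
    by_cases h : π.goodH m (n + 1)
    · have h1 := π.edgeH' h (Param.ctr 0 n0)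
      have h2 := π.edgeH h (Param.ctr 0 n0)
      rw [← hΓ] at h1 h2
      push_cast at h2
      rw [hs, hs]
      simp only [h1, h2]
    · simp [Param.gH, h]
  have sV : ∀ m n : ℤ, π.gV (m + 1) n * s m n = π.gV (m + 1) n * s (m + 1) n := by
    intro m n
    by_cases h : π.goodV (m + 1) n
    · have h1 := π.edgeV' h (Param.ctr 0 n0)
      have h2 := π.edgeV h (Param.ctr 0 n0)
      rw [← hΓ] at h1 h2
      push_cast at h2
      rw [hs, hs]
      simp only [h1, h2]
    · simp [Param.gV, h]
  obtain ⟨n0', hn0'⟩ : ∃ k : ℕ, (k : ℤ) = n0 := ⟨n0.toNat, by omega⟩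
  have cutH := Param.cut π.ω π.gH π.gV s (fun m n a b _ _ => π.square m n a b) sH sV
    (fun n => by simp [Param.gV, nV0]) (fun n => by simp [Param.gV, nVW])
    (fun m => by simp [Param.gH, nH0]) n0' (by omega)
  have cutV := Param.cut π.ω (fun m n => π.gV n m) (fun m n => π.gH n m) (fun m n => s n m)
    (fun m n _ _ a b => by rw [← π.square n m a b]; ring) (fun m n => sV n m) (fun m n => sH n m)
    (fun n => by simp [Param.gH, nH0]) (fun n => by simp [Param.gH, nHW])
    (fun m => by simp [Param.gV, nV0]) n0' (by omega)
  rw [hn0'] at cutH cutV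
  -- the second crossing of the horizontal line
  obtain ⟨m1, hm1W, hm1ne, hm1⟩ := Param.exists_other _ _ cutH 0 (by omega) (by
    rw [hs, Nat.cast_zero, if_pos hzΓ]; simp [Param.gH, hg0])
  have hm1g : π.goodH m1 n0 := by
    by_contra h; apply hm1; simp [Param.gH, h]
  have hm1Γ : Param.ctr m1 n0 ∈ Γ := by
    by_contra h; apply hm1; rw [hs, if_neg h, mul_zero]
  have hbig := π.goodH_cap hc (m := m1) (by omega) (by omega) hm1g
  have hbigR : (π.ω : ℝ) * π.ω ≤ 2 * π.q * (m1 + 1) := by exact_mod_cast hbig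
  have hn0m1 : n0 ≤ m1 := by
    by_contra hcon
    have h1 : (m1 : ℤ) + 1 ≤ n0 := by omega
    have hq := π.q_eq
    have hqi : (0 : ℤ) < π.q := by exact_mod_cast hqR
    nlinarith
  have hn0m1R : (n0 : ℝ) ≤ m1 := by exact_mod_cast hn0m1
  -- crossing of the vertical line
  have hv : (n0 : ℝ) ∈ Prod.fst '' Γ := by
    apply hprex.ordConnected.out ⟨_, hzΓ, rfl⟩ ⟨_, hm1Γ, rfl⟩
    have h3 : (1 : ℝ) ≤ n0 := by exact_mod_cast hn0
    constructor
    · simp only [Param.ctr]; push_cast; linarith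
    · simp only [Param.ctr]; push_cast; linarith
  obtain ⟨z, hzz, hzx⟩ := hv
  obtain ⟨b, hgb, hzb⟩ := π.plaid_x_int (hsub hzz) hzx
  have hbY := hy ⟨z, hzz, rfl⟩
  rw [hzb] at hbY
  have hb0 : 0 ≤ b := by
    have h1 : (-1 : ℝ) < b := by have := hbY.1; simp only at this; linarith
    have h2 : -1 < b := by exact_mod_cast h1
    omega
  have hbW : b < π.ω := by
    have h1 : (b : ℝ) < π.ω := by have := hbY.2; simp only at this; linarith
    exact_mod_cast h1
  have hbΓ : Param.ctr n0 b ∈ Γ := by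
    have h2 := π.edgeV hgb (Param.ctr 0 n0)
    rw [← hΓ] at h2
    rw [h2, ← hzb]; exact hzz
  obtain ⟨bn, hbn⟩ : ∃ k : ℕ, (k : ℤ) = b := ⟨b.toNat, by omega⟩
  obtain ⟨b', hb'W, hb'ne, hb'⟩ := Param.exists_other _ _ cutV bn (by omega) (by
    rw [hs, hbn, if_pos hbΓ]; simp [Param.gV, hgb])
  have hb'g : π.goodV n0 b' := by
    by_contra h; apply hb'; simp [Param.gV, h]
  have hb'Γ : Param.ctr n0 b' ∈ Γ := by
    by_contra h; apply hb'; rw [hs, if_neg h, mul_zero]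
  have hbb := π.goodV_cap hc hn0.le (by omega) hb0 hbW (b' := b') (by omega) (by omega) (by omega)
    hgb hb'g
  refine ⟨Γ, ⟨_, hz, hΓ⟩, ?_, ?_, ?_⟩
  · intro w hw
    have h1 := hx ⟨w, hw, rfl⟩
    have h2 := hy ⟨w, hw, rfl⟩
    exact ⟨⟨h1.1.le, h2.1.le⟩, ⟨h1.2.le, h2.2.le⟩⟩
  · have hbd : Bornology.IsBounded (Prod.fst '' Γ) := (Metric.isBounded_Ioo _ _).subset hx
    have hdist := Metric.dist_le_diam_of_mem hbd (Set.mem_image_of_mem _ hm1Γ)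
      (Set.mem_image_of_mem _ hzΓ)
    refine le_trans ?_ hdist
    rw [Real.dist_eq]
    refine le_trans ?_ (le_abs_self _)
    simp only [Param.ctr]
    push_cast
    rw [sub_le_iff_le_add, div_le_iff₀ (by positivity)]
    nlinarith
  · have hcont : Continuous (fun w : ℝ × ℝ => (w.1, (π.ω : ℝ) - w.2)) := by fun_prop
    have hpre' : IsPreconnected ((fun w : ℝ × ℝ => (w.1, (π.ω : ℝ) - w.2)) '' Γ) :=
      hpre.image _ hcont.continuousOn
    have hsub' : (fun w : ℝ × ℝ => (w.1, (π.ω : ℝ) - w.2)) '' Γ ⊆ π.plaidSet := by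
      rintro _ ⟨w, hw, rfl⟩
      have h1 := hx ⟨w, hw, rfl⟩
      exact π.plaid_refl (hsub hw) h1.1 h1.2
    have hmem : Param.ctr n0 b' ∈ (fun w : ℝ × ℝ => (w.1, (π.ω : ℝ) - w.2)) '' Γ := by
      refine ⟨_, hbΓ, ?_⟩
      rw [hbb]
      simp only [Param.ctr]
      push_cast
      ext
      · rfl
      · simp only; ring
    have hincl := hpre'.subset_connectedComponentIn hmem hsub'
    rw [hΓ] at hb'Γ
    rw [← connectedComponentIn_eq hb'Γ, ← hΓ] at hincl
    intro w hw
    exact hincl ⟨w, hw, rfl⟩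
end
end

section
/- Let {p_k/q_k} ⊂ (0,1) be a sequence of even rational parameters converging to an irrational limit. Then there is a fixed number R > 0 with the following property: for every k and every block B_k associated to p_k/q_k, and every point z ∈ B_k, the disk of radius R about z intersects at least one plaid polygon (for the parameter p_k/q_k) contained in B_k. -/
noncomputable section
open scoped Classical

namespace Param

variable (π : Param)

/-- The capacity of the horizontal line `y = c` of `𝓗` — and likewise of the vertical line
`x = c` of `𝓥`, since `F_V` is given by the same formula: `ω·|F_H|`. -/
def cap (c : ℤ) : ℝ := π.ω * |nrm (2 * π.P * c)|

/-- The mass of the `𝓟` line with `y`-intercept `(0,c)` — and likewise of the `𝓠` line with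
`y`-intercept `(0,c)`, since `F_P` and `F_Q` restrict to the same value on these lines. -/
def mass (c : ℤ) : ℝ := π.ω * |nrm (π.P * c + 1)|

/-- The block indexed by `(i,j)` : the translate of the square `[0,ω]²` by the lattice
vector `(ω² i, ω j)`. -/
def block (i j : ℤ) : Set (ℝ × ℝ) :=
  Set.Icc ((π.ω : ℝ) ^ 2 * i, (π.ω : ℝ) * j) ((π.ω : ℝ) ^ 2 * i + π.ω, (π.ω : ℝ) * j + π.ω)

end Param

lemma nrm_eq {x y : ℝ} (l : ℤ) (h : x = y + 2 * l) (h1 : -1 ≤ y) (h2 : y < 1) : nrm x = y := by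
  unfold nrm
  have : ⌊(x + 1) / 2⌋ = l := by
    rw [Int.floor_eq_iff]
    constructor <;> linarith
  rw [this]; linarith

lemma nrm_spec (x : ℝ) : ∃ l : ℤ, x = nrm x + 2 * l ∧ -1 ≤ nrm x ∧ nrm x < 1 := by
  refine ⟨⌊(x + 1) / 2⌋, ?_, ?_, ?_⟩
  · unfold nrm; ring
  · unfold nrm
    have := Int.floor_le ((x + 1) / 2)
    linarith
  · unfold nrm
    have := Int.lt_floor_add_one ((x + 1) / 2)
    linarith

lemma lightPair_pos {a b : ℝ} (h1 : 0 < b) (h2 : b < a) : lightPair a b := by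
  refine ⟨by nlinarith, ?_⟩
  rw [abs_of_pos h1, abs_of_pos (h1.trans h2)]; exact h2

lemma lightPair_neg {a b : ℝ} (h1 : b < 0) (h2 : a < b) : lightPair a b := by
  refine ⟨by nlinarith, ?_⟩
  rw [abs_of_neg h1, abs_of_neg (h2.trans h1)]; linarith

lemma not_lightPair_1 {a b : ℝ} (h1 : b ≤ 0) (h2 : 0 < a) : ¬ lightPair a b := by
  rintro ⟨h, -⟩; nlinarith

lemma not_lightPair_2 {a b : ℝ} (h1 : 0 ≤ b) (h2 : a < 0) : ¬ lightPair a b := by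
  rintro ⟨h, -⟩; nlinarith

/-- An arc of length `δ` on which exactly one of the two points is light. -/
lemma arc_exists (f D δ : ℝ) (hδ : 0 < δ) (hf : δ ≤ |f|) (hf1 : -1 ≤ f) (hf2 : f < 1)
    (hD : δ ≤ |nrm D|) :
    ∃ b : ℝ, ∀ X : ℝ, ∀ l : ℤ, b < X + 2 * l → X + 2 * l < b + δ →
      Xor (lightPair f (nrm X)) (lightPair f (nrm (X + D))) := by
  obtain ⟨s, hs, hs1, hs2⟩ := nrm_spec D
  set d := nrm D with hd
  have hδ1 : δ ≤ 1 := hf.trans (abs_le.2 ⟨hf1, hf2.le⟩)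
  rcases le_or_gt 0 f with hf0 | hf0
  · rw [abs_of_nonneg hf0] at hf
    rcases le_or_gt 0 d with hd0 | hd0
    · rw [abs_of_nonneg hd0] at hD
      refine ⟨-d, fun X l h1 h2 => ?_⟩
      have e1 : nrm X = X + 2 * l := nrm_eq (-l) (by push_cast; ring) (by linarith) (by linarith)
      have e2 : nrm (X + D) = X + 2 * l + d :=
        nrm_eq (s - l) (by rw [hs]; push_cast; ring) (by linarith) (by linarith)
      rw [e1, e2]
      exact Or.inr ⟨lightPair_pos (by linarith) (by linarith),
        not_lightPair_1 (by linarith) (by linarith)⟩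
    · rw [abs_of_neg hd0] at hD
      refine ⟨0, fun X l h1 h2 => ?_⟩
      have e1 : nrm X = X + 2 * l := nrm_eq (-l) (by push_cast; ring) (by linarith) (by linarith)
      have e2 : nrm (X + D) = X + 2 * l + d :=
        nrm_eq (s - l) (by rw [hs]; push_cast; ring) (by linarith) (by linarith)
      rw [e1, e2]
      exact Or.inl ⟨lightPair_pos (by linarith) (by linarith),
        not_lightPair_1 (by linarith) (by linarith)⟩
  · rw [abs_of_neg hf0] at hf
    rcases le_or_gt 0 d with hd0 | hd0
    · rw [abs_of_nonneg hd0] at hD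
      refine ⟨-δ, fun X l h1 h2 => ?_⟩
      have e1 : nrm X = X + 2 * l := nrm_eq (-l) (by push_cast; ring) (by linarith) (by linarith)
      have e2 : nrm (X + D) = X + 2 * l + d :=
        nrm_eq (s - l) (by rw [hs]; push_cast; ring) (by linarith) (by linarith)
      rw [e1, e2]
      exact Or.inl ⟨lightPair_neg (by linarith) (by linarith),
        not_lightPair_2 (by linarith) (by linarith)⟩
    · rw [abs_of_neg hd0] at hD
      refine ⟨-d - δ, fun X l h1 h2 => ?_⟩
      have e1 : nrm X = X + 2 * l := nrm_eq (-l) (by push_cast; ring) (by linarith) (by linarith)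
      have e2 : nrm (X + D) = X + 2 * l + d :=
        nrm_eq (s - l) (by rw [hs]; push_cast; ring) (by linarith) (by linarith)
      rw [e1, e2]
      exact Or.inr ⟨lightPair_neg (by linarith) (by linarith),
        not_lightPair_2 (by linarith) (by linarith)⟩

/-- Small steps hit every arc. -/
lemma hit_pos (e c δ b : ℝ) (hc : 0 < c) (h1 : c ≤ e) (h2 : e < δ) :
    ∃ i : ℕ, (i : ℝ) ≤ 2 / c + 1 ∧ ∃ l : ℤ, b < i * e + 2 * l ∧ i * e + 2 * l < b + δ := by
  have he : 0 < e := hc.trans_le h1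
  set a := b - 2 * ⌊b / 2⌋ with ha
  have ha0 : 0 ≤ a := by have := Int.floor_le (b / 2); linarith
  have ha2 : a < 2 := by have := Int.lt_floor_add_one (b / 2); linarith
  have hfl := Nat.floor_le (div_nonneg ha0 he.le)
  have hfl2 := Nat.lt_floor_add_one (a / e)
  refine ⟨⌊a / e⌋₊ + 1, ?_, ⌊b / 2⌋, ?_, ?_⟩
  · have : a / e ≤ 2 / c := by
      apply div_le_div₀ <;> linarith
    push_cast; linarith
  · have := (div_lt_iff₀ he).1 hfl2
    push_cast; linarith
  · have := (le_div_iff₀ he).1 hfl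
    push_cast; linarith

lemma hit (e c δ b : ℝ) (hc : 0 < c) (h1 : c ≤ |e|) (h2 : |e| < δ) :
    ∃ i : ℕ, (i : ℝ) ≤ 2 / c + 1 ∧ ∃ l : ℤ, b < i * e + 2 * l ∧ i * e + 2 * l < b + δ := by
  rcases le_or_gt 0 e with he | he
  · rw [abs_of_nonneg he] at h1 h2
    exact hit_pos e c δ b hc h1 h2
  · rw [abs_of_neg he] at h1 h2
    obtain ⟨i, hi, l, h3, h4⟩ := hit_pos (-e) c δ (-(b + δ)) hc h1 h2
    refine ⟨i, hi, -l, ?_, ?_⟩ <;> push_cast <;> linarith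

/-- A step along which the ceiling does not move. -/
lemma flat_step (P : ℝ) (J : ℕ) (hJ : 1 < J * (1 - P)) (m0 : ℤ) (hP : 0 ≤ P) :
    ∃ s : ℤ, m0 ≤ s ∧ s + 1 ≤ m0 + J ∧ ⌈P * ((s + 1 : ℤ) : ℝ)⌉ = ⌈P * (s : ℝ)⌉ := by
  by_contra! hcon
  have mono : ∀ s : ℤ, ⌈P * (s : ℝ)⌉ ≤ ⌈P * ((s + 1 : ℤ) : ℝ)⌉ := by
    intro s
    apply Int.ceil_mono
    push_cast; nlinarith
  have key : ∀ i : ℕ, i ≤ J → ⌈P * (m0 : ℝ)⌉ + i ≤ ⌈P * ((m0 + i : ℤ) : ℝ)⌉ := by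
    intro i
    induction i with
    | zero => simp
    | succ i ih =>
      intro hi
      have h1 := ih (by omega)
      have h2 := hcon (m0 + i) (by omega) (by omega)
      have h3 := mono (m0 + i)
      have h4 : (m0 + (i : ℤ) + 1) = m0 + ((i + 1 : ℕ) : ℤ) := by push_cast; ring
      rw [h4] at h2 h3
      push_cast at *
      omega
  have h1 := key J le_rfl
  have h2 : (⌈P * (m0 : ℝ)⌉ : ℝ) + J ≤ ⌈P * ((m0 + J : ℤ) : ℝ)⌉ := by exact_mod_cast h1
  have h3 := Int.ceil_lt_add_one (P * ((m0 + J : ℤ) : ℝ))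
  have h4 := Int.le_ceil (P * (m0 : ℝ))
  push_cast at h2 h3
  nlinarith

/-- Choice of a good column. -/
lemma column (P δ : ℝ) (J : ℕ) (hP : 0 ≤ P) (hJ : 1 < J * (1 - P))
    (hsep : ∀ j : ℕ, 1 ≤ j → j ≤ 2 * J + 1 → ∀ l : ℤ, δ ≤ |P * j - l|) (m0 : ℤ) :
    ∃ m : ℤ, m0 ≤ m ∧ m ≤ m0 + (2 * J + 1 : ℕ) ∧ (∀ l : ℤ, δ ≤ |2 * P * m - 2 * l|) ∧
      ∀ l : ℤ, δ ≤ |2 * P * m + P - 2 * P * ⌈P * (m : ℝ)⌉ - 2 * l| := by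
  obtain ⟨s, hs1, hs2, hs3⟩ := flat_step P J hJ m0 hP
  obtain ⟨t, ht1, ht2, ht3⟩ := flat_step P J hJ (m0 + J + 1) hP
  have sep : ∀ a b : ℤ, a < b → m0 ≤ a → b ≤ m0 + (2 * J + 1 : ℕ) →
      (∃ l : ℤ, |2 * P * a - 2 * l| < δ) → (∃ l : ℤ, |2 * P * b - 2 * l| < δ) → False := by
    rintro a b hab ha hb ⟨l, hl⟩ ⟨l', hl'⟩
    obtain ⟨j, hj⟩ := Int.eq_ofNat_of_zero_le (show 0 ≤ b - a by omega)
    have h := hsep j (by omega) (by omega) (l' - l)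
    have hj' : (j : ℝ) = b - a := by exact_mod_cast hj.symm
    rw [hj'] at h
    push_cast at h
    rw [abs_lt] at hl hl'
    rcases le_abs.1 h with h | h <;> nlinarith
  have fin : ∀ u : ℤ, m0 ≤ u → u + 1 ≤ m0 + (2 * J + 1 : ℕ) →
      ⌈P * ((u + 1 : ℤ) : ℝ)⌉ = ⌈P * (u : ℝ)⌉ →
      (∀ l : ℤ, δ ≤ |2 * P * u - 2 * l|) → (∀ l : ℤ, δ ≤ |2 * P * (u + 1 : ℤ) - 2 * l|) →
      ∃ m : ℤ, m0 ≤ m ∧ m ≤ m0 + (2 * J + 1 : ℕ) ∧ (∀ l : ℤ, δ ≤ |2 * P * m - 2 * l|) ∧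
      ∀ l : ℤ, δ ≤ |2 * P * m + P - 2 * P * ⌈P * (m : ℝ)⌉ - 2 * l| := by
    intro u h1 h2 h3 h4 h5
    by_cases h : ∀ l : ℤ, δ ≤ |2 * P * u + P - 2 * P * ⌈P * (u : ℝ)⌉ - 2 * l|
    · exact ⟨u, h1, by omega, h4, h⟩
    · refine ⟨u + 1, by omega, h2, h5, fun l' => ?_⟩
      rw [h3]
      push Not at h
      obtain ⟨l, hl⟩ := h
      by_contra! hl'
      have hh := hsep 1 le_rfl (by omega) (l' - l)
      push_cast at hh hl'
      rw [abs_lt] at hl hl'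
      rcases le_abs.1 hh with h | h <;> linarith
  by_cases hA : (∀ l : ℤ, δ ≤ |2 * P * s - 2 * l|) ∧ (∀ l : ℤ, δ ≤ |2 * P * (s + 1 : ℤ) - 2 * l|)
  · exact fin s hs1 (by push_cast; omega) hs3 hA.1 hA.2
  · have hb : ∃ a : ℤ, m0 ≤ a ∧ a ≤ m0 + J ∧ ∃ l : ℤ, |2 * P * a - 2 * l| < δ := by
      rw [not_and_or] at hA
      push Not at hA
      rcases hA with h | h
      · exact ⟨s, hs1, by omega, h⟩
      · exact ⟨s + 1, by omega, by omega, h⟩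
    obtain ⟨a, ha1, ha2, ha3⟩ := hb
    refine fin t (by omega) (by push_cast; omega) ht3 ?_ ?_
    · by_contra! h
      exact sep a t (by omega) ha1 (by push_cast; omega) ha3 h
    · by_contra! h
      exact sep a (t + 1) (by omega) ha1 (by push_cast; omega) ha3 h

namespace Param

variable (π : Param)

lemma ω_pos : 0 < π.ω := by have := π.p_pos; unfold ω; omega

lemma ω_odd : Odd π.ω := by
  have h := π.even_pq
  have hc := π.coprime
  unfold ω
  rw [Nat.even_mul] at h
  by_contra hn
  rw [Nat.not_odd_iff_even, Nat.even_add] at hn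
  have h1 : Even π.p := by tauto
  have h2 : Even π.q := by tauto
  have := Nat.dvd_gcd h1.two_dvd h2.two_dvd
  rw [hc] at this
  omega

lemma ω_coprime : Nat.Coprime π.ω π.p := by
  unfold ω
  rw [Nat.coprime_self_add_left]
  exact π.coprime.symm

lemma Pω : π.P * π.ω = 2 * π.p := by
  have : (π.ω : ℝ) ≠ 0 := by exact_mod_cast π.ω_pos.ne'
  unfold P; field_simp

lemma PQ : π.P + π.Q = 2 := by
  have : (π.ω : ℝ) ≠ 0 := by exact_mod_cast π.ω_pos.ne'
  unfold P Q; rw [← add_div, div_eq_iff this]; unfold ω; push_cast; ring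

lemma P_lt_one : π.P < 1 := by
  have h1 : (0 : ℝ) < π.ω := by exact_mod_cast π.ω_pos
  unfold P; rw [div_lt_one h1]; unfold ω
  have h2 : (π.p : ℝ) < π.q := by exact_mod_cast π.p_lt_q
  push_cast; linarith

lemma dvd_of_int (m z : ℤ) (h : π.P * m = z) : (π.ω : ℤ) ∣ m := by
  have h1 : 2 * (π.p : ℝ) * m = z * π.ω := by rw [← Pω, ← h]; ring
  have h2 : 2 * (π.p : ℤ) * m = z * π.ω := by exact_mod_cast h1
  have h3 : (π.ω : ℤ) ∣ 2 * (π.p : ℤ) * m := ⟨z, by rw [h2]; ring⟩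
  have h4 : IsCoprime (π.ω : ℤ) (2 * (π.p : ℤ)) := by
    apply IsCoprime.mul_right
    · have := Nat.isCoprime_iff_coprime.2 (Nat.coprime_two_right.2 π.ω_odd)
      exact_mod_cast this
    · exact Nat.isCoprime_iff_coprime.2 π.ω_coprime
  exact h4.dvd_of_dvd_mul_left h3

lemma count_line (S f : ℝ) (m n : ℤ) (hS : ∀ z : ℤ, S * m ≠ z) :
    Set.ncard {y : ℝ | y ∈ Set.Icc (n : ℝ) ((n : ℝ) + 1) ∧ (∃ c : ℤ, y + S * m = c) ∧
      lightPair f (nrm (π.P * y + π.P * S * m + 1))} =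
    if lightPair f (nrm (π.P * ((n + ⌈S * (m : ℝ)⌉ : ℤ) : ℝ) + 1)) then 1 else 0 := by
  have h1 := Int.le_ceil (S * (m : ℝ))
  have h2 := Int.ceil_lt_add_one (S * (m : ℝ))
  have huniq : ∀ y : ℝ, y ∈ Set.Icc (n : ℝ) ((n : ℝ) + 1) → (∃ c : ℤ, y + S * m = c) →
      y + S * m = ((n + ⌈S * (m : ℝ)⌉ : ℤ) : ℝ) := by
    rintro y ⟨hy1, hy2⟩ ⟨c, hc⟩
    rw [hc]
    congr 1
    have e1 : ⌈S * (m : ℝ)⌉ ≤ c - n := by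
      rw [Int.ceil_le]; push_cast; linarith
    have e2 : c - n - 1 < ⌈S * (m : ℝ)⌉ := by
      rw [Int.lt_ceil]
      refine lt_of_le_of_ne ?_ (hS (c - n - 1)).symm
      push_cast; linarith
    omega
  split_ifs with hl
  · rw [Set.ncard_eq_one]
    refine ⟨((n + ⌈S * (m : ℝ)⌉ : ℤ) : ℝ) - S * m, ?_⟩
    ext y
    simp only [Set.mem_setOf_eq, Set.mem_singleton_iff]
    constructor
    · rintro ⟨hy, hc, -⟩
      linarith [huniq y hy hc]
    · rintro rfl
      refine ⟨⟨?_, ?_⟩, ⟨_, sub_add_cancel _ _⟩, ?_⟩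
      · push_cast; linarith
      · push_cast; linarith
      · convert hl using 2
        ring
  · have : {y : ℝ | y ∈ Set.Icc (n : ℝ) ((n : ℝ) + 1) ∧ (∃ c : ℤ, y + S * m = c) ∧
      lightPair f (nrm (π.P * y + π.P * S * m + 1))} = ∅ := by
      ext y
      simp only [Set.mem_setOf_eq, Set.mem_empty_iff_false, iff_false]
      rintro ⟨hy, hc, hh⟩
      apply hl
      rw [← huniq y hy hc]
      convert hh using 2
      ring
    rw [this, Set.ncard_empty]

lemma goodV_of_xor (m n : ℤ) (hm : ¬ (π.ω : ℤ) ∣ m)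
    (h : Xor (lightPair (nrm (2 * π.P * m)) (nrm (π.P * (n + ⌈π.P * (m : ℝ)⌉) + 1)))
      (lightPair (nrm (2 * π.P * m)) (nrm (π.P * (n + (2 * m + 1 - ⌈π.P * (m : ℝ)⌉)) + 1)))) :
    π.goodV m n := by
  have hP : ∀ z : ℤ, π.P * m ≠ z := fun z hz => hm (π.dvd_of_int m z hz)
  have hQe : π.Q = 2 - π.P := by linarith [π.PQ]
  have hQ : ∀ z : ℤ, π.Q * m ≠ z := by
    intro z hz
    apply hP (2 * m - z)
    push_cast; rw [← hz, hQe]; ring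
  have hceil : ⌈π.Q * (m : ℝ)⌉ = 2 * m + 1 - ⌈π.P * (m : ℝ)⌉ := by
    rw [Int.ceil_eq_iff]
    have h1 := Int.le_ceil (π.P * (m : ℝ))
    have h2 := Int.ceil_lt_add_one (π.P * (m : ℝ))
    have h3 := lt_of_le_of_ne h1 (hP _)
    push_cast
    rw [hQe]
    constructor <;> linarith
  have c1 := π.count_line π.P (nrm (2 * π.P * m)) m n hP
  have c2 := π.count_line π.Q (nrm (2 * π.P * m)) m n hQ
  rw [hceil] at c2
  push_cast at c1 c2
  have s1 : {y : ℝ | y ∈ Set.Icc (n : ℝ) ((n : ℝ) + 1) ∧ π.lightVP ((m : ℝ), y)} =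
      {y : ℝ | y ∈ Set.Icc (n : ℝ) ((n : ℝ) + 1) ∧ (∃ c : ℤ, y + π.P * m = c) ∧
      lightPair (nrm (2 * π.P * m)) (nrm (π.P * y + π.P * π.P * m + 1))} := by
    ext y
    simp only [lightVP, onV, onP, FV, FP, Set.mem_setOf_eq, sq]
    have : ∃ n : ℤ, (m : ℝ) = n := ⟨m, rfl⟩
    tauto
  have s2 : {y : ℝ | y ∈ Set.Icc (n : ℝ) ((n : ℝ) + 1) ∧ π.lightVQ ((m : ℝ), y)} =
      {y : ℝ | y ∈ Set.Icc (n : ℝ) ((n : ℝ) + 1) ∧ (∃ c : ℤ, y + π.Q * m = c) ∧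
      lightPair (nrm (2 * π.P * m)) (nrm (π.P * y + π.P * π.Q * m + 1))} := by
    ext y
    simp only [lightVQ, onV, onQ, FV, FQ, Set.mem_setOf_eq]
    have : ∃ n : ℤ, (m : ℝ) = n := ⟨m, rfl⟩
    tauto
  unfold goodV vLightCount
  rw [s1, s2, c1, c2]
  rcases h with ⟨h1, h2⟩ | ⟨h1, h2⟩
  · rw [if_pos h1, if_neg h2]
  · rw [if_pos h1, if_neg h2]

lemma nrm_zero_of_dvd (i : ℤ) : nrm (2 * π.P * ((π.ω * i : ℤ) : ℝ)) = 0 := by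
  apply nrm_eq (2 * π.p * i) _ (by norm_num) (by norm_num)
  have := π.Pω
  push_cast
  linear_combination (2 * (i : ℝ)) * this

lemma not_lightPair_zero (b : ℝ) : ¬ lightPair 0 b := by
  rintro ⟨h, -⟩; simp at h

lemma not_goodV_s9 (i n : ℤ) : ¬ π.goodV (π.ω * i) n := by
  have h0 := π.nrm_zero_of_dvd i
  have h1 : ∀ y, ¬ π.lightVP (((π.ω * i : ℤ) : ℝ), y) := by
    rintro y ⟨-, -, h⟩
    simp only [FV] at h
    rw [h0] at h
    exact not_lightPair_zero _ h
  have h2 : ∀ y, ¬ π.lightVQ (((π.ω * i : ℤ) : ℝ), y) := by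
    rintro y ⟨-, -, h⟩
    simp only [FV] at h
    rw [h0] at h
    exact not_lightPair_zero _ h
  unfold goodV vLightCount
  simp only [h1, h2, and_false, Set.setOf_false, Set.ncard_empty]
  norm_num

lemma not_goodH_s9 (i n : ℤ) : ¬ π.goodH n (π.ω * i) := by
  have h0 := π.nrm_zero_of_dvd i
  have h1 : ∀ y, ¬ π.lightHP (y, ((π.ω * i : ℤ) : ℝ)) := by
    rintro y ⟨-, -, h⟩
    simp only [FH] at h
    rw [h0] at h
    exact not_lightPair_zero _ h
  have h2 : ∀ y, ¬ π.lightHQ (y, ((π.ω * i : ℤ) : ℝ)) := by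
    rintro y ⟨-, -, h⟩
    simp only [FH] at h
    rw [h0] at h
    exact not_lightPair_zero _ h
  unfold goodH hLightCount
  simp only [h1, h2, and_false, false_and, Set.setOf_false, Set.ncard_empty]
  norm_num

lemma int_half (m k : ℤ) : (m : ℝ) + 1 / 2 ≠ k := by
  intro h
  have : (2 * m + 1 : ℝ) = 2 * k := by linarith
  have : 2 * m + 1 = 2 * k := by exact_mod_cast this
  omega

lemma seg_coord {a b c d : ℝ} {z : ℝ × ℝ} (h : z ∈ segment ℝ (a, b) (c, d)) :
    ∃ s : ℝ, 0 ≤ s ∧ s ≤ 1 ∧ z.1 = a + s * (c - a) ∧ z.2 = b + s * (d - b) := by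
  obtain ⟨u, v, hu, hv, huv, rfl⟩ := h
  have : u = 1 - v := by linarith
  subst this
  refine ⟨v, hv, by linarith, ?_, ?_⟩ <;> simp <;> ring

lemma half_seg_low {m k : ℤ} {s t : ℝ} (h0 : 0 ≤ s) (h1 : s ≤ 1)
    (ht : t = (m : ℝ) + 1 / 2 + s * ((m : ℝ) - ((m : ℝ) + 1 / 2))) (hk : t = k) : k = m := by
  have e1 : (k : ℝ) < m + 1 := by linarith
  have e2 : (m : ℝ) ≤ k := by linarith
  have e1' : k < m + 1 := by exact_mod_cast e1
  have e2' : m ≤ k := by exact_mod_cast e2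
  omega

lemma half_seg_high {m k : ℤ} {s t : ℝ} (h0 : 0 ≤ s) (h1 : s ≤ 1)
    (ht : t = (m : ℝ) + 1 / 2 + s * ((m : ℝ) + 1 - ((m : ℝ) + 1 / 2))) (hk : t = k) :
    k = m + 1 := by
  have e1 : (k : ℝ) ≤ m + 1 := by linarith
  have e2 : (m : ℝ) < k := by linarith
  have e1' : k ≤ m + 1 := by exact_mod_cast e1
  have e2' : m < k := by exact_mod_cast e2
  omega

lemma plaid_avoid {z : ℝ × ℝ} (hz : z ∈ π.plaidSet) (i : ℤ) :
    z.1 ≠ ((π.ω * i : ℤ) : ℝ) ∧ z.2 ≠ ((π.ω * i : ℤ) : ℝ) := by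
  obtain ⟨m, n, ⟨hg, hs⟩ | ⟨hg, hs⟩ | ⟨hg, hs⟩ | ⟨hg, hs⟩⟩ := hz
  · obtain ⟨s, h0, h1, hx, hy⟩ := seg_coord hs
    refine ⟨fun h => int_half m _ (by rw [← h, hx]; ring), fun h => ?_⟩
    have := half_seg_low h0 h1 hy h
    subst this
    exact π.not_goodH_s9 _ _ hg
  · obtain ⟨s, h0, h1, hx, hy⟩ := seg_coord hs
    refine ⟨fun h => int_half m _ (by rw [← h, hx]; ring), fun h => ?_⟩
    have := half_seg_high h0 h1 hy h
    rw [← this] at hg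
    exact π.not_goodH_s9 _ _ hg
  · obtain ⟨s, h0, h1, hx, hy⟩ := seg_coord hs
    refine ⟨fun h => ?_, fun h => int_half n _ (by rw [← h, hy]; ring)⟩
    have := half_seg_low h0 h1 hx h
    subst this
    exact π.not_goodV_s9 _ _ hg
  · obtain ⟨s, h0, h1, hx, hy⟩ := seg_coord hs
    refine ⟨fun h => ?_, fun h => int_half n _ (by rw [← h, hy]; ring)⟩
    have := half_seg_high h0 h1 hx h
    rw [← this] at hg
    exact π.not_goodV_s9 _ _ hg

/-- A good vertical edge in the interior columns of a block yields a polygon in the block. -/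
lemma polygon_of_goodV (i j m n : ℤ) (hg : π.goodV m n)
    (hm1 : (π.ω : ℤ) ^ 2 * i < m) (hm2 : m < (π.ω : ℤ) ^ 2 * i + π.ω)
    (hn1 : (π.ω : ℤ) * j ≤ n) (hn2 : n < (π.ω : ℤ) * j + π.ω) :
    ∃ Γ : Set (ℝ × ℝ), π.IsPlaidPolygon Γ ∧ Γ ⊆ π.block i j ∧
      ((m : ℝ), (n : ℝ) + 1 / 2) ∈ Γ := by
  set w : ℝ × ℝ := ((m : ℝ), (n : ℝ) + 1 / 2) with hw
  have hwS : w ∈ π.plaidSet :=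
    ⟨m, n, Or.inr (Or.inr (Or.inl ⟨hg, right_mem_segment ℝ _ _⟩))⟩
  refine ⟨connectedComponentIn π.plaidSet w, ⟨w, hwS, rfl⟩, ?_, mem_connectedComponentIn hwS⟩
  have hpre := isPreconnected_connectedComponentIn (x := w) (F := π.plaidSet)
  set A : ℝ := (π.ω : ℝ) ^ 2 * i with hA
  set B : ℝ := (π.ω : ℝ) * j with hB
  have a1 : A < m := by rw [hA]; exact_mod_cast hm1
  have a2 : (m : ℝ) < A + π.ω := by rw [hA]; exact_mod_cast hm2
  have b1 : B ≤ n := by rw [hB]; exact_mod_cast hn1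
  have b2 : (n : ℝ) + 1 ≤ B + π.ω := by rw [hB]; exact_mod_cast hn2
  set U : Set (ℝ × ℝ) := Set.Ioo A (A + π.ω) ×ˢ Set.Ioo B (B + π.ω) with hU
  have hUo : IsOpen U := isOpen_Ioo.prod isOpen_Ioo
  have hVo : IsOpen (π.block i j)ᶜ := by
    unfold block; exact isClosed_Icc.isOpen_compl
  have hUb : U ⊆ π.block i j := by
    rintro ⟨x, y⟩ ⟨⟨h1, h2⟩, ⟨h3, h4⟩⟩
    exact ⟨⟨h1.le, h3.le⟩, ⟨h2.le, h4.le⟩⟩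
  refine (hpre.subset_left_of_subset_union hUo hVo ?_ ?_ ?_).trans hUb
  · exact Set.disjoint_compl_right_iff_subset.2 hUb
  · intro z hz
    have hzS := connectedComponentIn_subset _ _ hz
    by_cases hb : z ∈ π.block i j
    · left
      obtain ⟨⟨h1, h3⟩, ⟨h2, h4⟩⟩ := hb
      have e1 := (π.plaid_avoid hzS (π.ω * i)).1
      have e2 := (π.plaid_avoid hzS (π.ω * i + 1)).1
      have e3 := (π.plaid_avoid hzS j).2
      have e4 := (π.plaid_avoid hzS (j + 1)).2
      refine ⟨⟨lt_of_le_of_ne h1 ?_, lt_of_le_of_ne h2 ?_⟩,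
        ⟨lt_of_le_of_ne h3 ?_, lt_of_le_of_ne h4 ?_⟩⟩
      · intro h; apply e1; rw [← h]; push_cast; ring
      · intro h; apply e2; rw [h]; push_cast; ring
      · intro h; apply e3; rw [← h]; push_cast; ring
      · intro h; apply e4; rw [h]; push_cast; ring
    · exact Or.inr hb
  · refine ⟨w, mem_connectedComponentIn hwS, ⟨a1, a2⟩, ?_, ?_⟩
    · show B < (n : ℝ) + 1 / 2
      linarith
    · show (n : ℝ) + 1 / 2 < B + π.ω
      linarith

lemma not_dvd_of_between (i m : ℤ) (h1 : (π.ω : ℤ) ^ 2 * i < m)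
    (h2 : m < (π.ω : ℤ) ^ 2 * i + π.ω) : ¬ (π.ω : ℤ) ∣ m := by
  rintro ⟨k, rfl⟩
  have hω : (0 : ℤ) < π.ω := by exact_mod_cast π.ω_pos
  have e1 : π.ω * i < k := by
    apply lt_of_mul_lt_mul_left _ hω.le; nlinarith
  have e2 : k < π.ω * i + 1 := by
    apply lt_of_mul_lt_mul_left _ hω.le; nlinarith
  omega

/-- Solving the congruence for `n` in a prescribed window. -/
lemma solve (t : ℤ) (j : ℤ) : ∃ n l : ℤ, (π.ω : ℤ) * j ≤ n ∧ n < (π.ω : ℤ) * j + π.ω ∧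
    π.p * n = t + l * π.ω := by
  have hω : (0 : ℤ) < π.ω := by exact_mod_cast π.ω_pos
  obtain ⟨u, v, huv⟩ := Nat.isCoprime_iff_coprime.2 π.ω_coprime
  have hn := Int.emod_add_mul_ediv (v * t) π.ω
  refine ⟨π.ω * j + (v * t) % π.ω, π.p * j - u * t - π.p * ((v * t) / π.ω), ?_, ?_, ?_⟩
  · have := Int.emod_nonneg (v * t) hω.ne'; omega
  · have := Int.emod_lt_of_pos (v * t) hω; omega
  · linear_combination (π.p : ℤ) * hn + t * huv

/-- Every block contains a good edge. -/
lemma exists_good (i j : ℤ) : ∃ m n : ℤ, π.goodV m n ∧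
    (π.ω : ℤ) ^ 2 * i < m ∧ m < (π.ω : ℤ) ^ 2 * i + π.ω ∧
    (π.ω : ℤ) * j ≤ n ∧ n < (π.ω : ℤ) * j + π.ω := by
  have hω3 : 3 ≤ π.ω := by
    have := π.p_pos; have := π.p_lt_q; unfold ω; omega
  have hωR : (3 : ℝ) ≤ π.ω := by exact_mod_cast hω3
  have hω0 : (0 : ℝ) < π.ω := by linarith
  have hPω := π.Pω
  have hP1 := π.P_lt_one
  have hP0 := π.P_pos
  obtain ⟨h, hh⟩ := π.ω_odd
  have hhR : (π.ω : ℝ) = 2 * h + 1 := by exact_mod_cast hh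
  set m : ℤ := (π.ω : ℤ) ^ 2 * i + 1 with hm
  have hm1 : (π.ω : ℤ) ^ 2 * i < m := by omega
  have hm2 : m < (π.ω : ℤ) ^ 2 * i + π.ω := by omega
  have hmR : (m : ℝ) = (π.ω : ℝ) ^ 2 * i + 1 := by rw [hm]; push_cast; ring
  have hPm : π.P * m = ((2 * π.p * π.ω * i : ℤ) : ℝ) + π.P := by
    rw [hmR]; push_cast; linear_combination (π.ω * i : ℝ) * hPω
  have ha : ⌈π.P * (m : ℝ)⌉ = 2 * π.p * π.ω * i + 1 := by
    rw [hPm, Int.ceil_intCast_add]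
    congr 1
    rw [Int.ceil_eq_iff]
    push_cast
    constructor <;> linarith
  have hinv : 0 < 1 / (π.ω : ℝ) := by positivity
  have hP2 : 2 / (π.ω : ℝ) ≤ π.P := by
    rw [div_le_iff₀ hω0, hPω]
    have : (1 : ℝ) ≤ π.p := by exact_mod_cast π.p_pos
    linarith
  have h2inv : 2 / (π.ω : ℝ) = 1 / π.ω + 1 / π.ω := by ring
  have hinvω : 1 / (π.ω : ℝ) * π.ω = 1 := by field_simp
  obtain ⟨l, hl, hl1, hl2⟩ := nrm_spec (2 * π.P * m)
  set f := nrm (2 * π.P * m) with hf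
  have hfω : f * π.ω = ((2 * (2 * π.p * m - l * π.ω) : ℤ) : ℝ) := by
    push_cast; linear_combination (2 * m : ℝ) * hPω - (π.ω : ℝ) * hl
  have hne : 2 * π.p * m - l * π.ω ≠ 0 := by
    intro h0
    apply π.not_dvd_of_between i m hm1 hm2
    apply π.dvd_of_int m l
    have : (2 * π.p * m : ℝ) = l * π.ω := by
      have : 2 * π.p * m = l * π.ω := by omega
      exact_mod_cast this
    have hh : (π.P * m - l) * π.ω = 0 := by linear_combination (m : ℝ) * hPω + this
    rcases mul_eq_zero.1 hh with h | h
    · linarith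
    · linarith
  have hnd := π.not_dvd_of_between i m hm1 hm2
  rcases lt_or_gt_of_ne hne with hlt | hgt
  · have hfneg : f ≤ -(2 / π.ω) := by
      rw [← neg_div, le_div_iff₀ hω0, hfω]
      have : 2 * (2 * π.p * m - l * π.ω) ≤ -2 := by omega
      exact_mod_cast this
    -- want P(n+a)+1 = -1/ω mod 2
    obtain ⟨n, k, hn1, hn2, hn3⟩ := π.solve (-(π.p * (2 * π.p * π.ω * i + 1)) - (h + 1)) j
    have hn3' : (π.p : ℝ) * n = -(π.p * (2 * π.p * π.ω * i + 1)) - (h + 1) + k * π.ω := by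
      exact_mod_cast hn3
    have key : π.P * (n + (2 * π.p * π.ω * i + 1)) + 1 = -(1 / π.ω) + 2 * k := by
      apply mul_right_cancel₀ hω0.ne'
      linear_combination (n + (2 * π.p * π.ω * i + 1) : ℝ) * hPω + 2 * hn3' + hhR + hinvω
    refine ⟨m, n, π.goodV_of_xor m n hnd ?_, hm1, hm2, hn1, hn2⟩
    rw [← hf, ha]
    left
    constructor
    · rw [nrm_eq k (y := -(1 / π.ω)) (by push_cast; exact key) (by linarith) (by linarith)]
      exact lightPair_neg (by linarith) (by linarith)
    · rw [nrm_eq (k + 2 * π.p * π.ω * i - 4 * π.p ^ 2 * i) (y := π.P - 1 / π.ω) ?_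
        (by linarith) (by linarith)]
      · exact not_lightPair_2 (by linarith) (by linarith)
      · push_cast at hPm ⊢
        linear_combination key + 2 * hPm - (4 * π.p * i : ℝ) * hPω
  · have hfpos : 2 / π.ω ≤ f := by
      rw [div_le_iff₀ hω0, hfω]
      have : 2 ≤ 2 * (2 * π.p * m - l * π.ω) := by omega
      exact_mod_cast this
    obtain ⟨n, k, hn1, hn2, hn3⟩ := π.solve (-(π.p * (2 * π.p * π.ω * i + 1)) - π.p - h) j
    have hn3' : (π.p : ℝ) * n = -(π.p * (2 * π.p * π.ω * i + 1)) - π.p - h + k * π.ω := by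
      exact_mod_cast hn3
    have key : π.P * (n + (2 * π.p * π.ω * i + 1)) + 1 = 1 / π.ω - π.P + 2 * k := by
      apply mul_right_cancel₀ hω0.ne'
      linear_combination (n + (2 * π.p * π.ω * i + 1) + 1 : ℝ) * hPω + 2 * hn3' + hhR - hinvω
    refine ⟨m, n, π.goodV_of_xor m n hnd ?_, hm1, hm2, hn1, hn2⟩
    rw [← hf, ha]
    right
    constructor
    · rw [nrm_eq (k + 2 * π.p * π.ω * i - 4 * π.p ^ 2 * i) (y := 1 / π.ω) ?_
        (by linarith) (by linarith)]
      · exact lightPair_pos (by linarith) (by linarith)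
      · push_cast at hPm ⊢
        linear_combination key + 2 * hPm - (4 * π.p * i : ℝ) * hPω
    · rw [nrm_eq k (y := 1 / π.ω - π.P) (by push_cast; exact key) (by linarith) (by linarith)]
      exact not_lightPair_1 (by linarith) (by linarith)

/-- The conclusion of the theorem for one parameter and one radius. -/
def NoGap (R : ℝ) : Prop := ∀ (i j : ℤ), ∀ z ∈ π.block i j,
  ∃ Γ : Set (ℝ × ℝ), π.IsPlaidPolygon Γ ∧ Γ ⊆ π.block i j ∧ (Γ ∩ Metric.ball z R).Nonempty

lemma NoGap.mono {R R' : ℝ} (h : π.NoGap R) (hR : R ≤ R') : π.NoGap R' := by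
  intro i j z hz
  obtain ⟨Γ, h1, h2, h3⟩ := h i j z hz
  exact ⟨Γ, h1, h2, h3.mono (Set.inter_subset_inter_right _ (Metric.ball_subset_ball hR))⟩

lemma mem_ball_of {a b R : ℝ} {z : ℝ × ℝ} (h1 : |a - z.1| < R) (h2 : |b - z.2| < R) :
    (a, b) ∈ Metric.ball z R := by
  rw [Metric.mem_ball, Prod.dist_eq, max_lt_iff, Real.dist_eq, Real.dist_eq]
  exact ⟨h1, h2⟩

lemma noGap_single : π.NoGap (2 * π.ω) := by
  intro i j z hz
  obtain ⟨m, n, hg, h1, h2, h3, h4⟩ := π.exists_good i j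
  obtain ⟨Γ, e1, e2, e3⟩ := π.polygon_of_goodV i j m n hg h1 h2 h3 h4
  refine ⟨Γ, e1, e2, _, e3, ?_⟩
  have hω : (0 : ℝ) < π.ω := by exact_mod_cast π.ω_pos
  obtain ⟨⟨z1, z3⟩, ⟨z2, z4⟩⟩ := hz
  have w := e2 e3
  obtain ⟨⟨w1, w3⟩, ⟨w2, w4⟩⟩ := w
  simp only at z1 z2 z3 z4 w1 w2 w3 w4
  apply mem_ball_of
  · rw [abs_lt]; constructor <;> linarith
  · rw [abs_lt]; constructor <;> linarith

lemma clamp (M w : ℕ) (h : M + 2 ≤ w) (t : ℝ) (h0 : 0 ≤ t) (h1 : t ≤ w) :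
    ∃ m : ℤ, 1 ≤ m ∧ m + M ≤ w - 1 ∧ |(m : ℝ) - t| ≤ M + 2 := by
  have f1 := Int.floor_le t
  have f2 := Int.lt_floor_add_one t
  have hM : (0 : ℝ) ≤ M := Nat.cast_nonneg _
  by_cases ha : ⌊t⌋ < 1
  · refine ⟨1, le_rfl, by omega, ?_⟩
    have : (⌊t⌋ : ℝ) ≤ 0 := by exact_mod_cast (show ⌊t⌋ ≤ 0 by omega)
    rw [abs_le]; push_cast; constructor <;> linarith
  · by_cases hb : ⌊t⌋ ≤ w - 1 - M
    · refine ⟨⌊t⌋, by omega, by omega, ?_⟩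
      rw [abs_le]; constructor <;> linarith
    · refine ⟨w - 1 - M, by omega, by omega, ?_⟩
      have : ((w : ℝ) - 1 - M) < ⌊t⌋ := by exact_mod_cast (show (w : ℤ) - 1 - M < ⌊t⌋ by omega)
      rw [abs_le]; push_cast; constructor <;> linarith

/-- The uniform estimate. -/
lemma noGap_uniform (δ c : ℝ) (J d N : ℕ) (r : ℤ) (hδ : 0 < δ) (hc : 0 < c)
    (hJ : 1 < J * (1 - π.P))
    (hsep : ∀ j : ℕ, 1 ≤ j → j ≤ 2 * J + 1 → ∀ l : ℤ, δ ≤ |π.P * j - l|)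
    (h1 : c ≤ |π.P * d - 2 * r|) (h2 : |π.P * d - 2 * r| < δ)
    (hN : (d : ℝ) * (2 / c + 1) ≤ N) (hω : (2 * J + 1) + N + 2 ≤ π.ω) :
    π.NoGap (2 * (2 * J + 1) + 2 * N + 5) := by
  intro i j z hz
  obtain ⟨⟨z1, z3⟩, ⟨z2, z4⟩⟩ := hz
  simp only at z1 z2 z3 z4
  obtain ⟨m0, a1, a2, a3⟩ := clamp (2 * J + 1) π.ω (by omega) (z.1 - (π.ω : ℝ) ^ 2 * i)
    (by linarith) (by linarith)
  obtain ⟨n0, b1, b2, b3⟩ := clamp N π.ω (by omega) (z.2 - (π.ω : ℝ) * j)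
    (by linarith) (by linarith)
  obtain ⟨m, c1, c2, c3, c4⟩ := column π.P δ J π.P_pos.le hJ hsep ((π.ω : ℤ) ^ 2 * i + m0)
  have hm1 : (π.ω : ℤ) ^ 2 * i < m := by omega
  have hm2 : m < (π.ω : ℤ) ^ 2 * i + π.ω := by omega
  have hnd := π.not_dvd_of_between i m hm1 hm2
  set a := ⌈π.P * (m : ℝ)⌉ with ha
  set D := 2 * π.P * m + π.P - 2 * π.P * a with hD
  obtain ⟨l1, hl1, hf1, hf2⟩ := nrm_spec (2 * π.P * m)
  obtain ⟨l2, hl2, -, -⟩ := nrm_spec D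
  have hfδ : δ ≤ |nrm (2 * π.P * m)| := by
    have := c3 l1
    rwa [show 2 * π.P * m - 2 * l1 = nrm (2 * π.P * m) by linarith] at this
  have hDδ : δ ≤ |nrm D| := by
    have := c4 l2
    rwa [show D - 2 * l2 = nrm D by linarith] at this
  obtain ⟨b, hb⟩ := arc_exists _ D δ hδ hfδ hf1 hf2 hDδ
  obtain ⟨k, hk, l, hl, hl'⟩ := hit (π.P * d - 2 * r) c δ
    (b - (π.P * (π.ω * j + n0 + a) + 1)) hc h1 h2
  set n : ℤ := π.ω * j + n0 + d * k with hn
  have hdk : (d : ℝ) * k ≤ N := (mul_le_mul_of_nonneg_left hk (Nat.cast_nonneg _)).trans hN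
  have hdk' : (d : ℤ) * k ≤ N := by exact_mod_cast hdk
  have hdk0 : (0 : ℤ) ≤ (d : ℤ) * k := by positivity
  have hdk0' : (0 : ℝ) ≤ (d : ℝ) * k := by positivity
  have hnR : (n : ℝ) = π.ω * j + n0 + d * k := by rw [hn]; push_cast; ring
  have hx := hb (π.P * (n + a) + 1) (l - k * r)
    (by rw [hnR]; push_cast; linarith) (by rw [hnR]; push_cast; linarith)
  rw [show π.P * (n + a) + 1 + D = π.P * (n + (2 * m + 1 - a)) + 1 by rw [hD]; ring] at hx
  have hg := π.goodV_of_xor m n hnd hx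
  obtain ⟨Γ, e1, e2, e3⟩ := π.polygon_of_goodV i j m n hg hm1 hm2 (by omega) (by omega)
  refine ⟨Γ, e1, e2, _, e3, ?_⟩
  have c1' : (π.ω : ℝ) ^ 2 * i + m0 ≤ m := by exact_mod_cast c1
  have c2' : (m : ℝ) ≤ (π.ω : ℝ) ^ 2 * i + m0 + (2 * J + 1) := by exact_mod_cast c2
  have hN0 : (0 : ℝ) ≤ N := Nat.cast_nonneg _
  have hJ0 : (0 : ℝ) ≤ J := Nat.cast_nonneg _
  rw [abs_le] at a3 b3
  push_cast at a3
  apply mem_ball_of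
  · rw [abs_lt]; constructor <;> linarith
  · rw [hnR, abs_lt]; constructor <;> linarith

end Param

/-- Multiples of an irrational are uniformly away from the integers. -/
lemma sep_irrational (α : ℝ) (hα : Irrational α) (M : ℕ) :
    ∃ δ : ℝ, 0 < δ ∧ ∀ j : ℕ, 1 ≤ j → j ≤ M → ∀ l : ℤ, δ ≤ |α * j - l| := by
  induction M with
  | zero => exact ⟨1, one_pos, fun j h1 h2 => by omega⟩
  | succ M ih =>
    obtain ⟨δ, hδ, h⟩ := ih
    have hirr : Irrational (α * ((M + 1 : ℕ) : ℝ)) := hα.mul_natCast (by omega)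
    refine ⟨min δ |α * ((M + 1 : ℕ) : ℝ) - round (α * ((M + 1 : ℕ) : ℝ))|, ?_, ?_⟩
    · refine lt_min hδ (abs_pos.2 (sub_ne_zero.2 ?_))
      exact hirr.ne_int _
    · intro j h1 h2 l
      rcases Nat.lt_or_ge M j with hj | hj
      · have : j = M + 1 := by omega
        subst this
        exact (min_le_right _ _).trans (round_le _ _)
      · exact (min_le_left _ _).trans (h j h1 hj l)

lemma sep_eventually (P : ℕ → ℝ) (α : ℝ) (hα : Irrational α)
    (hP : Filter.Tendsto P Filter.atTop (nhds α)) (M : ℕ) :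
    ∃ δ : ℝ, 0 < δ ∧ ∀ᶠ k in Filter.atTop,
      ∀ j : ℕ, 1 ≤ j → j ≤ M → ∀ l : ℤ, δ ≤ |P k * j - l| := by
  obtain ⟨δ, hδ, h⟩ := sep_irrational α hα M
  refine ⟨δ / 2, by positivity, ?_⟩
  have hM : (0 : ℝ) < M + 1 := by positivity
  filter_upwards [Metric.tendsto_nhds.1 hP (δ / 2 / (M + 1)) (by positivity)] with k hk j h1 h2 l
  rw [Real.dist_eq, lt_div_iff₀ hM] at hk
  have h3 := h j h1 h2 l
  have hj : (j : ℝ) ≤ M + 1 := by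
    have : (j : ℝ) ≤ M := by exact_mod_cast h2
    linarith
  have h4 : |P k * j - α * j| ≤ δ / 2 := by
    rw [← sub_mul, abs_mul, Nat.abs_cast]
    exact (mul_le_mul_of_nonneg_left hj (abs_nonneg _)).trans hk.le
  have h5 : |α * j - l| ≤ |α * j - P k * j| + |P k * j - l| := abs_sub_le _ _ _
  rw [abs_sub_comm (α * j) (P k * j)] at h5
  linarith

lemma P_tendsto (π : ℕ → Param) (x : ℝ) (hx0 : 0 ≤ x)
    (hconv : Filter.Tendsto (fun k => ((π k).p : ℝ) / ((π k).q : ℝ))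
      Filter.atTop (nhds x)) :
    Filter.Tendsto (fun k => (π k).P) Filter.atTop (nhds (2 * x / (x + 1))) := by
  have h := (hconv.const_mul 2).div (hconv.add_const 1) (by linarith)
  refine h.congr fun k => ?_
  have hq : ((π k).q : ℝ) ≠ 0 := by
    have := (π k).p_lt_q
    exact_mod_cast (by omega : (π k).q ≠ 0)
  have hp : (0 : ℝ) ≤ (π k).p := Nat.cast_nonneg _
  have hq' : (0 : ℝ) < (π k).q := lt_of_le_of_ne (Nat.cast_nonneg _) hq.symm
  have h2 : ((π k).p : ℝ) + (π k).q ≠ 0 := by positivity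
  simp only [Pi.div_apply, Param.P, Param.ω]
  push_cast
  field_simp

lemma eventually_noGap (π : ℕ → Param) (x : ℝ) (hx : Irrational x)
    (hconv : Filter.Tendsto (fun k => ((π k).p : ℝ) / ((π k).q : ℝ))
      Filter.atTop (nhds x)) :
    ∃ R : ℝ, ∀ᶠ k in Filter.atTop, (π k).NoGap R := by
  have hx0 : 0 ≤ x := ge_of_tendsto' hconv fun k => by positivity
  have hx1 : x ≤ 1 := le_of_tendsto' hconv fun k => by
    apply div_le_one_of_le₀ _ (Nat.cast_nonneg _)
    exact_mod_cast (π k).p_lt_q.le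
  have hx1' : x < 1 := lt_of_le_of_ne hx1 hx.ne_one
  have hP := P_tendsto π x hx0 hconv
  set α := 2 * x / (x + 1) with hα
  have hα1 : α < 1 := by rw [hα, div_lt_one (by linarith)]; linarith
  have hirr : Irrational α := by
    rintro ⟨y, hy⟩
    have h1 : α * (x + 1) = 2 * x := by rw [hα]; field_simp
    apply hx
    refine ⟨y / (2 - y), ?_⟩
    push_cast
    rw [hy, div_eq_iff (by linarith)]
    linarith
  obtain ⟨J, hJ⟩ := exists_nat_gt (1 / (1 - α))
  have hJ' : 1 < J * (1 - α) := (div_lt_iff₀ (by linarith)).1 hJ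
  have evJ : ∀ᶠ k in Filter.atTop, 1 < (J : ℝ) * (1 - (π k).P) :=
    ((hP.const_sub 1).const_mul (J : ℝ)).eventually (lt_mem_nhds hJ')
  obtain ⟨δ, hδ, evδ⟩ := sep_eventually _ α hirr hP (2 * J + 1)
  -- Dirichlet
  obtain ⟨T, hT⟩ := exists_nat_gt (2 / δ)
  have hT0 : (0 : ℝ) < T := lt_trans (by positivity) hT
  obtain ⟨d, hd0, hdT, hd⟩ := Real.exists_nat_abs_mul_sub_round_le (α / 2)
    (show 0 < T by exact_mod_cast hT0)
  set r : ℤ := round ((d : ℝ) * (α / 2)) with hr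
  have hirr2 : Irrational (α * d) := hirr.mul_natCast (by omega)
  have hepos : 0 < |α * d - 2 * r| := by
    rw [abs_pos, sub_ne_zero]
    have := hirr2.ne_int (2 * r)
    push_cast at this
    exact this
  have helt : |α * d - 2 * r| < δ := by
    have e : α * d - 2 * r = 2 * ((d : ℝ) * (α / 2) - r) := by ring
    rw [e, abs_mul, abs_two]
    have h1 : 1 / ((T : ℝ) + 1) < δ / 2 := by
      rw [div_lt_iff₀ (by positivity)]
      rw [div_lt_iff₀ hδ] at hT
      nlinarith
    linarith
  set c := |α * d - 2 * r| / 2 with hc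
  have hc0 : 0 < c := by positivity
  have hlim : Filter.Tendsto (fun k => |(π k).P * d - 2 * r|) Filter.atTop
      (nhds |α * d - 2 * r|) := ((hP.mul_const (d : ℝ)).sub_const _).abs
  have ev1 := hlim.eventually (lt_mem_nhds (show c < |α * d - 2 * r| by rw [hc]; linarith))
  have ev2 := hlim.eventually (gt_mem_nhds helt)
  obtain ⟨N, hN⟩ := exists_nat_ge ((d : ℝ) * (2 / c + 1))
  obtain ⟨ε, hε, evε⟩ := sep_eventually _ α hirr hP ((2 * J + 1) + N + 2)
  refine ⟨2 * (2 * J + 1) + 2 * N + 5, ?_⟩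
  filter_upwards [evJ, evδ, ev1, ev2, evε] with k k1 k2 k3 k4 k5
  refine (π k).noGap_uniform δ c J d N r hδ hc0 k1 k2 k3.le k4 hN ?_
  by_contra! hlt
  have := k5 (π k).ω (π k).ω_pos hlt.le (2 * (π k).p)
  rw [(π k).Pω] at this
  push_cast at this
  rw [sub_self, abs_zero] at this
  linarith

/-- **No big gaps.**  Let `p_k/q_k` be a sequence of even rational parameters converging to an
irrational limit.  Then there is a fixed `R > 0` such that for every `k`, every block `B`
associated to `p_k/q_k`, and every point `z ∈ B`, the disk of radius `R` about `z` intersects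
at least one plaid polygon (for the parameter `p_k/q_k`) contained in `B`. -/
theorem no_big_gaps (π : ℕ → Param) (x : ℝ) (hx : Irrational x)
    (hconv : Filter.Tendsto (fun k => ((π k).p : ℝ) / ((π k).q : ℝ))
      Filter.atTop (nhds x)) :
    ∃ R : ℝ, 0 < R ∧ ∀ (k : ℕ) (i j : ℤ), ∀ z ∈ (π k).block i j,
      ∃ Γ : Set (ℝ × ℝ), (π k).IsPlaidPolygon Γ ∧ Γ ⊆ (π k).block i j ∧
        (Γ ∩ Metric.ball z R).Nonempty := by
  obtain ⟨R, hR⟩ := eventually_noGap π x hx hconv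
  obtain ⟨K, hK⟩ := Filter.eventually_atTop.1 hR
  have hfin : ∃ R' : ℝ, ∀ k < K, (π k).NoGap R' := by
    clear hK
    induction K with
    | zero => exact ⟨0, fun k hk => by omega⟩
    | succ K ih =>
      obtain ⟨R', h⟩ := ih
      refine ⟨max R' (2 * (π K).ω), fun k hk => ?_⟩
      rcases Nat.lt_or_ge k K with h1 | h1
      · exact (h k h1).mono _ (le_max_left _ _)
      · have : k = K := by omega
        subst this
        exact (π k).noGap_single.mono _ (le_max_right _ _)
  obtain ⟨R', hR'⟩ := hfin
  refine ⟨max 1 (max R R'), lt_of_lt_of_le one_pos (le_max_left _ _), fun k => ?_⟩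
  rcases Nat.lt_or_ge k K with h1 | h1
  · exact (hR' k h1).mono _ ((le_max_right _ _).trans (le_max_right _ _))
  · exact (hK k h1).mono _ ((le_max_left _ _).trans (le_max_right _ _))
end
end
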